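/- arXiv:1901.09897 — 2 statements merged into one kernel-verified Lean document; each statement's English description precedes it below -/
import Mathlib

section
/- Let n ≥ 2, let Ω ⊆ ℝⁿ be any open set, and let μ be a Borel measure on Ω that is α-upper Ahlfors regular with constant C_μ for some α ∈ (n−1, n]. If 1 < p < n and 1 ≤ q ≤ ∞, then there exists a constant C = C(n, p, q, α, C_μ) such that ‖u‖_{L^{αp/(n−p), q}(Ω, μ)} ≤ C ( ‖Eu‖_{L^{p,q}(Ω)} + ‖u‖_{L^{p(n−1)/(n−p), q}(∂Ω)} ) for every u ∈ E¹L^{p,q}(Ω) ∩ C_b(Ω̄), where the boundary Lorentz norm is taken with respect to H^{n−1}. -/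
open MeasureTheory Set
open scoped ENNReal NNReal

noncomputable section

/-- Euclidean space `ℝⁿ`. -/
abbrev Euc (n : ℕ) := EuclideanSpace ℝ (Fin n)

/-- The decreasing rearrangement of `f` with respect to the measure `ν`,
`f*_ν(s) = inf { t ≥ 0 : ν({|f| > t}) ≤ s }`. -/
def rearr {α : Type*} [MeasurableSpace α] (ν : Measure α) (f : α → ℝ) (s : ℝ) : ℝ≥0∞ :=
  sInf {t : ℝ≥0∞ | ν {x | t < ENNReal.ofReal |f x|} ≤ ENNReal.ofReal s}

/-- `E : Ω → ℝ^{n×n}` (indexed by pairs, with the euclidean (Frobenius) norm) is the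
distributional symmetric gradient of `u` on the open set `Ω`, with `u` and `E` locally
integrable on `Ω`:  for all test functions `φ` compactly supported in `Ω`,
`∫_Ω (uⁱ ∂_j φ + uʲ ∂_i φ) = -2 ∫_Ω E_{ij} φ`. -/
def IsSymmGradOn (n : ℕ) (Ω : Set (Euc n)) (u : Euc n → Euc n)
    (E : Euc n → EuclideanSpace ℝ (Fin n × Fin n)) : Prop :=
  MeasureTheory.LocallyIntegrableOn u Ω volume ∧
  MeasureTheory.LocallyIntegrableOn E Ω volume ∧
  ∀ φ : Euc n → ℝ, ContDiff ℝ (⊤ : ℕ∞) φ → HasCompactSupport φ → tsupport φ ⊆ Ω →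
    ∀ i j : Fin n,
      (∫ x in Ω, (u x i * fderiv ℝ φ x (EuclideanSpace.single j 1)
          + u x j * fderiv ℝ φ x (EuclideanSpace.single i 1))) =
        - ∫ x in Ω, 2 * E x (i, j) * φ x

/-- Membership in `C_b(Ω̄)`: continuity on `Ω̄` and bounded support. -/
def MemCb (n : ℕ) (Ω : Set (Euc n)) (u : Euc n → Euc n) : Prop :=
  ContinuousOn u (closure Ω) ∧ Bornology.IsBounded {x ∈ closure Ω | u x ≠ 0}

/-- `μ` is `α`-upper Ahlfors regular on `Ω` with constant `Cμ`:
`μ(B_r(x) ∩ Ω) ≤ Cμ rᵅ` for all `x ∈ Ω`, `r > 0`. -/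
def AhlforsUpper (n : ℕ) (Ω : Set (Euc n)) (μ : Measure (Euc n)) (α Cμ : ℝ) : Prop :=
  ∀ x ∈ Ω, ∀ r : ℝ, 0 < r → μ (Metric.ball x r ∩ Ω) ≤ ENNReal.ofReal (Cμ * r ^ α)

/-- The ray from `x` in direction `θ` meets `∂Ω`. -/
def hitsBoundary {n : ℕ} (Ω : Set (Euc n)) (x θ : Euc n) : Prop :=
  ∃ t : ℝ, 0 < t ∧ x + t • θ ∈ frontier Ω

/-- The first time at which the ray from `x` in direction `θ` meets `∂Ω`. -/
def zetaTime {n : ℕ} (Ω : Set (Euc n)) (x θ : Euc n) : ℝ :=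
  sInf {t : ℝ | 0 < t ∧ x + t • θ ∈ frontier Ω}

/-- `ζ(x,θ)`: the first point at which the ray from `x` in direction `θ` meets `∂Ω`
(for an open `Ω`, this is the unique point of `(∂Ω)ₓ` on the ray). -/
def zeta {n : ℕ} (Ω : Set (Euc n)) (x θ : Euc n) : Euc n :=
  x + zetaTime Ω x θ • θ

/-- The Lorentz `L^{p,q}` (quasi-)norm, `‖s^{1/p-1/q} f*(s)‖_{L^q(0,∞)}` (with the usual
supremum expression when `q = ∞`). -/
def lorentzNorm {α : Type*} [MeasurableSpace α] (ν : Measure α) (p : ℝ) (q : ℝ≥0∞)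
    (f : α → ℝ) : ℝ≥0∞ :=
  if q = ⊤ then ⨆ s ∈ Set.Ioi (0 : ℝ), ENNReal.ofReal (s ^ (1 / p)) * rearr ν f s
  else (∫⁻ s in Set.Ioi (0 : ℝ),
      (ENNReal.ofReal (s ^ (1 / p - 1 / q.toReal)) * rearr ν f s) ^ q.toReal) ^ (1 / q.toReal)

/-- The Lorentz–Zygmund `L^{∞,q;-1}` norm,
`‖s^{-1/q} (log(1 + ν(R)/s))⁻¹ f*(s)‖_{L^q(0, ν(R))}`. -/
def lorentzZygmundNorm {α : Type*} [MeasurableSpace α] (ν : Measure α) (q : ℝ)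
    (f : α → ℝ) : ℝ≥0∞ :=
  (∫⁻ s in Set.Ioo (0 : ℝ) (ν Set.univ).toReal,
      (ENNReal.ofReal (s ^ (-(1 / q)) * (Real.log (1 + (ν Set.univ).toReal / s))⁻¹)
        * rearr ν f s) ^ q) ^ (1 / q)

/-- The Luxemburg (Orlicz) norm associated with the Young-type function `A`. -/
def luxemburgNorm {α : Type*} [MeasurableSpace α] (ν : Measure α) (A : ℝ → ℝ)
    (f : α → ℝ) : ℝ≥0∞ :=
  sInf (ENNReal.ofReal ''
    {lam : ℝ | 0 < lam ∧ ∫⁻ x, ENNReal.ofReal (A (|f x| / lam)) ∂ν ≤ 1})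

/-- `A(t) = e^{t^σ} - 1`, the Young function of the exponential space `exp L^σ`. -/
def expYoung (σ t : ℝ) : ℝ := Real.exp (t ^ σ) - 1

/-- `A(t) = e^{e^{t^σ}} - e`, the Young function of the space `exp exp L^σ`. -/
def expexpYoung (σ t : ℝ) : ℝ := Real.exp (Real.exp (t ^ σ)) - Real.exp 1

/-- `A(t) = t^p log^σ(1+t)`, the Young function of the Zygmund space `L^p (log L)^σ`. -/
def zygYoung (p σ t : ℝ) : ℝ := t ^ p * Real.log (1 + t) ^ σ

/-- An abstract rearrangement-invariant function norm on `(0,∞)` (the representation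
norm of a rearrangement-invariant space), recorded together with the properties of such
norms used here: monotonicity, subadditivity, homogeneity and boundedness of dilations. -/
structure RINorm where
  N : (ℝ → ℝ≥0∞) → ℝ≥0∞
  mono : ∀ f g : ℝ → ℝ≥0∞, (∀ s, 0 < s → f s ≤ g s) → N f ≤ N g
  add_le : ∀ f g : ℝ → ℝ≥0∞, N (fun s => f s + g s) ≤ N f + N g
  smul_le : ∀ (c : ℝ≥0∞) (f : ℝ → ℝ≥0∞), N (fun s => c * f s) ≤ c * N f
  dilate : ∀ c : ℝ, 0 < c → ∀ f : ℝ → ℝ≥0∞,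
    N (fun s => f (c * s)) ≤ ENNReal.ofReal (max 1 c⁻¹) * N f

/-- The Riesz kernel `|x - y|^{1-n}`, equal to `∞` on the diagonal. -/
def rieszKernel {n : ℕ} (x y : Euc n) : ℝ≥0∞ := edist x y ^ (1 - (n : ℝ))

theorem measurable_rieszKernel_right {n : ℕ} (x : Euc n) : Measurable (rieszKernel x) :=
  (measurable_const.edist measurable_id).pow_const _

theorem measurable_rieszKernel_left {n : ℕ} (y : Euc n) :
    Measurable (fun x => rieszKernel x y) :=
  (measurable_id.edist measurable_const).pow_const _

theorem measurable_rieszKernel {n : ℕ} :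
    Measurable (fun z : Euc n × Euc n => rieszKernel z.1 z.2) :=
  (measurable_fst.edist measurable_snd).pow_const _

theorem rieszKernel_eq_ofReal {n : ℕ} {x y : Euc n} (h : x ≠ y) :
    rieszKernel x y = ENNReal.ofReal (dist x y ^ (1 - (n : ℝ))) := by
  rw [rieszKernel, edist_dist, ENNReal.ofReal_rpow_of_pos (dist_pos.2 h)]

theorem rieszKernel_self {n : ℕ} (hn : 2 ≤ n) (x : Euc n) : rieszKernel x x = ⊤ := by
  have : (2 : ℝ) ≤ n := by exact_mod_cast hn
  rw [rieszKernel, edist_self, ENNReal.zero_rpow_of_neg (by linarith)]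

theorem rieszKernel_le_of_le_dist {n : ℕ} (hn : 2 ≤ n) {x y : Euc n} {r : ℝ} (hr : 0 < r)
    (h : r ≤ dist x y) : rieszKernel x y ≤ ENNReal.ofReal (r ^ (1 - (n : ℝ))) := by
  have h2 : (2 : ℝ) ≤ n := by exact_mod_cast hn
  rw [rieszKernel_eq_ofReal (dist_pos.1 (hr.trans_le h))]
  exact ENNReal.ofReal_le_ofReal (Real.rpow_le_rpow_of_nonpos hr h (by linarith))

/-- Dyadic pointwise bound of the Riesz kernel by indicators of balls. -/
theorem rieszKernel_le_dyadic {n : ℕ} (hn : 2 ≤ n) {ρ : ℝ} (hρ : 0 < ρ) (x z : Euc n) :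
    rieszKernel x z ≤ ENNReal.ofReal (ρ ^ (1 - (n : ℝ))) +
      ∑' j : ℕ, (Metric.ball z ((1 / 2) ^ j * ρ)).indicator
        (fun _ => ENNReal.ofReal (((1 / 2) ^ (j + 1) * ρ) ^ (1 - (n : ℝ)))) x := by
  have h2 : (2 : ℝ) ≤ n := by exact_mod_cast hn
  rcases le_or_gt ρ (dist x z) with h | h
  · exact (rieszKernel_le_of_le_dist hn hρ h).trans le_self_add
  refine le_trans ?_ le_add_self
  rcases eq_or_ne x z with rfl | hne
  · refine le_top.trans (le_of_eq ?_)
    symm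
    rw [eq_top_iff, ← ENNReal.tsum_const_eq_top_of_ne_zero (α := ℕ)
      (c := ENNReal.ofReal (ρ ^ (1 - (n : ℝ)))) (by
        rw [ENNReal.ofReal_ne_zero_iff]; positivity)]
    refine ENNReal.tsum_le_tsum fun j => ?_
    rw [indicator_of_mem (Metric.mem_ball_self (by positivity))]
    refine ENNReal.ofReal_le_ofReal (Real.rpow_le_rpow_of_nonpos (by positivity) ?_ (by linarith))
    exact mul_le_of_le_one_left hρ.le (pow_le_one₀ (by norm_num) (by norm_num))
  · have hd := dist_pos.2 hne
    obtain ⟨j, hj1, hj2⟩ := exists_nat_pow_near_of_lt_one (x := dist x z / ρ) (y := (1 / 2 : ℝ))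
      (by positivity) (by rw [div_le_one hρ]; exact h.le) (by norm_num) (by norm_num)
    rcases eq_or_lt_of_le hj2 with hj2 | hj2
    · rcases j with _ | j
      · rw [pow_zero, div_eq_one_iff_eq hρ.ne'] at hj2
        exact absurd hj2 h.ne
      · refine le_trans ?_ (ENNReal.le_tsum j)
        have e : dist x z = (1 / 2) ^ (j + 1) * ρ := by rw [← hj2]; field_simp
        rw [indicator_of_mem]
        · exact rieszKernel_le_of_le_dist hn (by positivity) e.ge
        · rw [Metric.mem_ball, e, pow_succ]
          have : (0 : ℝ) < (1 / 2) ^ j * ρ := by positivity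
          nlinarith
    · refine le_trans ?_ (ENNReal.le_tsum j)
      rw [indicator_of_mem]
      · exact rieszKernel_le_of_le_dist hn (by positivity) ((lt_div_iff₀ hρ).1 hj1).le
      · exact (div_lt_iff₀ hρ).1 hj2

/-- For an upper Ahlfors regular measure `ν` of dimension `β > n - 1`, the Riesz potential of
`ν` is bounded by a power of the total mass. -/
theorem exists_lintegral_rieszKernel_le (n : ℕ) (hn : 2 ≤ n) (β D : ℝ) (hβ : (n : ℝ) - 1 < β)
    (hD : 0 < D) :
    ∃ K : ℝ≥0, ∀ ν : Measure (Euc n), ν univ ≠ ⊤ →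
      (∀ z, ∀ r : ℝ, 0 < r → ν (Metric.ball z r) ≤ ENNReal.ofReal (D * r ^ β)) →
      ∀ z, ∫⁻ x, rieszKernel x z ∂ν ≤ K * ν univ ^ (1 - ((n : ℝ) - 1) / β) := by
  have h2 : (2 : ℝ) ≤ n := by exact_mod_cast hn
  have hβ0 : 0 < β := by linarith
  set g : ℝ := β - (n - 1) with hg
  have hg0 : 0 < g := by linarith
  set c : ℝ := (1 / 2) ^ g with hc
  have hc1 : c < 1 := Real.rpow_lt_one (by norm_num) (by norm_num) hg0
  have hc0 : 0 < c := by positivity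
  have key : ∃ K : ℝ≥0, (1 : ℝ≥0∞) + ENNReal.ofReal (D * (1 / 2) ^ (1 - (n : ℝ))) *
      (1 - ENNReal.ofReal c)⁻¹ = K := by
    refine ⟨_, (ENNReal.coe_toNNReal ?_).symm⟩
    refine ENNReal.add_ne_top.2 ⟨ENNReal.one_ne_top, ENNReal.mul_ne_top ENNReal.ofReal_ne_top ?_⟩
    rw [ENNReal.inv_ne_top]
    exact (tsub_pos_of_lt (by simpa using hc1)).ne'
  obtain ⟨K, hK⟩ := key
  refine ⟨K, fun ν hν hball z => ?_⟩
  rcases eq_or_ne (ν univ) 0 with h0 | h0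
  · rw [Measure.measure_univ_eq_zero.1 h0]; simp
  set M := (ν univ).toReal with hM
  have hM0 : 0 < M := ENNReal.toReal_pos h0 hν
  set ρ := M ^ (1 / β) with hρd
  have hρ : 0 < ρ := by positivity
  have hρβ : ρ ^ β = M := by
    rw [hρd, ← Real.rpow_mul hM0.le]; simp [hβ0.ne']
  have hMe : ν univ = ENNReal.ofReal M := (ENNReal.ofReal_toReal hν).symm
  have hρg : ρ ^ g = M ^ (1 - ((n : ℝ) - 1) / β) := by
    rw [hρd, ← Real.rpow_mul hM0.le]; congr 1; rw [hg]; field_simp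
  have e1 : ρ ^ (1 - (n : ℝ)) * M = ρ ^ g := by
    rw [← hρβ, ← Real.rpow_add hρ]; congr 1; rw [hg]; ring
  calc ∫⁻ x, rieszKernel x z ∂ν
      ≤ ∫⁻ x, (ENNReal.ofReal (ρ ^ (1 - (n : ℝ))) +
      ∑' j : ℕ, (Metric.ball z ((1 / 2) ^ j * ρ)).indicator
        (fun _ => ENNReal.ofReal (((1 / 2) ^ (j + 1) * ρ) ^ (1 - (n : ℝ)))) x) ∂ν :=
        lintegral_mono fun x => rieszKernel_le_dyadic hn hρ x z
    _ = ENNReal.ofReal (ρ ^ (1 - (n : ℝ))) * ν univ + ∑' j : ℕ,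
        ENNReal.ofReal (((1 / 2) ^ (j + 1) * ρ) ^ (1 - (n : ℝ))) *
          ν (Metric.ball z ((1 / 2) ^ j * ρ)) := by
        rw [lintegral_add_left measurable_const, lintegral_const, lintegral_tsum]
        · simp_rw [lintegral_indicator_const Metric.isOpen_ball.measurableSet]
        · exact fun j => (measurable_const.indicator Metric.isOpen_ball.measurableSet).aemeasurable
    _ ≤ ENNReal.ofReal (ρ ^ g) + ∑' j : ℕ,
        ENNReal.ofReal (ρ ^ g) * (ENNReal.ofReal (D * (1 / 2) ^ (1 - (n : ℝ))) *
          ENNReal.ofReal c ^ j) := by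
        refine add_le_add (le_of_eq ?_) (ENNReal.tsum_le_tsum fun j => ?_)
        · rw [hMe, ← ENNReal.ofReal_mul (by positivity), e1]
        · refine (mul_le_mul_right (hball z _ (by positivity)) _).trans (le_of_eq ?_)
          rw [← ENNReal.ofReal_pow hc0.le, ← ENNReal.ofReal_mul (by positivity),
            ← ENNReal.ofReal_mul (by positivity), ← ENNReal.ofReal_mul (by positivity)]
          congr 1
          have a1 : c ^ j = ((1 / 2 : ℝ) ^ j) ^ g := by
            rw [hc, ← Real.rpow_natCast, ← Real.rpow_natCast, ← Real.rpow_mul (by norm_num),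
              ← Real.rpow_mul (by norm_num), mul_comm]
          rw [a1, pow_succ, Real.mul_rpow (by positivity) hρ.le,
            Real.mul_rpow (by positivity) (by positivity),
            Real.mul_rpow (by positivity) hρ.le, hg]
          have a2 : ρ ^ (β - ((n : ℝ) - 1)) = ρ ^ (1 - (n : ℝ)) * ρ ^ β := by
            rw [← Real.rpow_add hρ]; congr 1; ring
          have hj : (0 : ℝ) < (1 / 2) ^ j := by positivity
          have a3 : ((1 / 2 : ℝ) ^ j) ^ (β - ((n : ℝ) - 1)) =
              ((1 / 2 : ℝ) ^ j) ^ (1 - (n : ℝ)) * ((1 / 2 : ℝ) ^ j) ^ β := by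
            rw [← Real.rpow_add hj]; congr 1; ring
          rw [a2, a3]; ring
    _ = ENNReal.ofReal (ρ ^ g) * K := by
        rw [ENNReal.tsum_mul_left, ENNReal.tsum_mul_left, ENNReal.tsum_geometric, ← hK, mul_add,
          mul_one]
    _ = K * ν univ ^ (1 - ((n : ℝ) - 1) / β) := by
        rw [hρg, mul_comm, hMe, ENNReal.ofReal_rpow_of_pos hM0]

theorem rieszKernel_comm {n : ℕ} (x y : Euc n) : rieszKernel x y = rieszKernel y x := by
  rw [rieszKernel, rieszKernel, edist_comm]

theorem volume_euc_ball {n : ℕ} (z : Euc n) {r : ℝ} (hr : 0 < r) :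
    volume (Metric.ball z r) = ENNReal.ofReal (r ^ n) * volume (Metric.ball (0 : Euc n) 1) := by
  rw [Measure.addHaar_ball_of_pos _ _ hr, finrank_euclideanSpace_fin]

/-- The Riesz potential of the indicator of a set of finite volume. -/
theorem exists_setLIntegral_rieszKernel_le (n : ℕ) (hn : 2 ≤ n) :
    ∃ K : ℝ≥0, ∀ A : Set (Euc n), volume A ≠ ⊤ → ∀ x,
      ∫⁻ y in A, rieszKernel x y ≤ K * volume A ^ (1 / (n : ℝ)) := by
  have h2 : (2 : ℝ) ≤ n := by exact_mod_cast hn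
  set v := (volume (Metric.ball (0 : Euc n) 1)).toReal with hv
  have hvtop : volume (Metric.ball (0 : Euc n) 1) ≠ ⊤ := measure_ball_lt_top.ne
  have hv0 : 0 < v := ENNReal.toReal_pos (Metric.measure_ball_pos _ _ one_pos).ne' hvtop
  obtain ⟨K, hK⟩ := exists_lintegral_rieszKernel_le n hn n v (by linarith) hv0
  refine ⟨K, fun A hA x => ?_⟩
  have := hK (volume.restrict A) (by simpa using hA) (fun z r hr => ?_) x
  · simp_rw [rieszKernel_comm x]
    convert this using 3
    · simp
    · field_simp; ring
  · refine (Measure.restrict_apply_le _ _).trans (le_of_eq ?_)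
    rw [volume_euc_ball z hr, ← ENNReal.ofReal_toReal hvtop, ← ENNReal.ofReal_mul (by positivity),
      Real.rpow_natCast, mul_comm]

/-- The average of the Riesz kernel over a ball is controlled by its value at the centre. -/
theorem exists_setLIntegral_ball_rieszKernel_le (n : ℕ) (hn : 2 ≤ n) :
    ∃ K : ℝ≥0, ∀ (x z : Euc n) (r : ℝ), 0 < r →
      ∫⁻ y in Metric.ball z r, rieszKernel x y ≤
        K * (ENNReal.ofReal (r ^ n) * rieszKernel x z) := by
  have h2 : (2 : ℝ) ≤ n := by exact_mod_cast hn
  obtain ⟨K, hK⟩ := exists_setLIntegral_rieszKernel_le n hn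
  have hvtop : volume (Metric.ball (0 : Euc n) 1) ≠ ⊤ := measure_ball_lt_top.ne
  set v := (volume (Metric.ball (0 : Euc n) 1)).toNNReal with hv
  have hve : volume (Metric.ball (0 : Euc n) 1) = v := (ENNReal.coe_toNNReal hvtop).symm
  set a : ℝ≥0 := Real.toNNReal (2 ^ ((n : ℝ) - 1)) with ha
  refine ⟨K * v ^ (1 / (n : ℝ)) * a + v * a, fun x z r hr => ?_⟩
  have hconst : ENNReal.ofReal ((2 : ℝ) ^ ((n : ℝ) - 1)) = a := rfl
  rcases lt_or_ge (dist x z) (2 * r) with h | h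
  · refine (hK _ measure_ball_lt_top.ne x).trans ?_
    have e1 : volume (Metric.ball z r) ^ (1 / (n : ℝ)) =
        ENNReal.ofReal r * (v : ℝ≥0∞) ^ (1 / (n : ℝ)) := by
      rw [volume_euc_ball z hr, hve, ENNReal.mul_rpow_of_nonneg _ _ (by positivity),
        ENNReal.ofReal_rpow_of_pos (by positivity), ← Real.rpow_natCast, ← Real.rpow_mul hr.le,
        mul_one_div_cancel (by positivity), Real.rpow_one]
    have e2 : ENNReal.ofReal r ≤ a * (ENNReal.ofReal (r ^ n) * rieszKernel x z) := by
      rcases eq_or_ne x z with rfl | hne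
      · rw [rieszKernel_self hn, ENNReal.mul_top (by simpa using pow_pos hr n), ENNReal.mul_top]
        · exact le_top
        · rw [← hconst, ENNReal.ofReal_ne_zero_iff]; positivity
      · have hd := dist_pos.2 hne
        rw [rieszKernel_eq_ofReal hne, ← hconst, ← ENNReal.ofReal_mul (by positivity),
          ← ENNReal.ofReal_mul (by positivity)]
        apply ENNReal.ofReal_le_ofReal
        have : (2 * r) ^ (1 - (n : ℝ)) ≤ dist x z ^ (1 - (n : ℝ)) :=
          Real.rpow_le_rpow_of_nonpos hd h.le (by linarith)
        calc r = 2 ^ ((n : ℝ) - 1) * (r ^ n * (2 * r) ^ (1 - (n : ℝ))) := by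
              rw [Real.mul_rpow (by norm_num) hr.le, ← Real.rpow_natCast]
              have b1 : (2 : ℝ) ^ ((n : ℝ) - 1) * 2 ^ (1 - (n : ℝ)) = 1 := by
                rw [← Real.rpow_add (by norm_num)]; simp
              have b2 : r ^ (n : ℝ) * r ^ (1 - (n : ℝ)) = r := by
                rw [← Real.rpow_add hr]; simp
              calc r = (2 ^ ((n : ℝ) - 1) * 2 ^ (1 - (n : ℝ))) * (r ^ (n : ℝ) * r ^ (1 - (n : ℝ))) := by
                    rw [b1, b2, one_mul]
                _ = _ := by ring
          _ ≤ _ := by gcongr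
    rw [e1, ENNReal.coe_add, add_mul]
    refine le_trans ?_ le_self_add
    calc (K : ℝ≥0∞) * (ENNReal.ofReal r * (v : ℝ≥0∞) ^ (1 / (n : ℝ)))
        ≤ K * (a * (ENNReal.ofReal (r ^ n) * rieszKernel x z) * (v : ℝ≥0∞) ^ (1 / (n : ℝ))) := by
          gcongr
      _ = _ := by
          rw [ENNReal.coe_mul, ENNReal.coe_mul, ENNReal.coe_rpow_of_nonneg _ (by positivity)]
          ring
  · have hne : x ≠ z := dist_pos.1 (by linarith)
    have hd := dist_pos.2 hne
    rw [ENNReal.coe_add, add_mul]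
    refine le_trans ?_ le_add_self
    calc ∫⁻ y in Metric.ball z r, rieszKernel x y
        ≤ ∫⁻ y in Metric.ball z r, ENNReal.ofReal ((dist x z / 2) ^ (1 - (n : ℝ))) := by
          refine setLIntegral_mono measurable_const fun y hy => ?_
          refine rieszKernel_le_of_le_dist hn (by positivity) ?_
          have := dist_triangle x y z
          have := Metric.mem_ball.1 hy
          linarith
      _ = a * rieszKernel x z * (ENNReal.ofReal (r ^ n) * v) := by
          rw [setLIntegral_const, volume_euc_ball z hr, hve, rieszKernel_eq_ofReal hne, ← hconst,
            ← ENNReal.ofReal_mul (by positivity), div_eq_mul_inv,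
            Real.mul_rpow hd.le (by norm_num), Real.inv_rpow (by norm_num),
            ← Real.rpow_neg (by norm_num), neg_sub, mul_comm (dist x z ^ _)]
      _ = _ := by rw [ENNReal.coe_mul]; ring

/-- Mollifying the Riesz kernel does not increase it by more than a constant factor. -/
theorem exists_lintegral_normed_mul_rieszKernel_le (n : ℕ) (hn : 2 ≤ n) :
    ∃ K : ℝ≥0, ∀ (φ : ContDiffBump (0 : Euc n)), φ.rOut ≤ 2 * φ.rIn → ∀ x z : Euc n,
      ∫⁻ y, ENNReal.ofReal (φ.normed volume (y - z)) * rieszKernel x y ≤ K * rieszKernel x z := by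
  obtain ⟨K, hK⟩ := exists_setLIntegral_ball_rieszKernel_le n hn
  have hvtop : volume (Metric.ball (0 : Euc n) 1) ≠ ⊤ := measure_ball_lt_top.ne
  have hv0 : volume (Metric.ball (0 : Euc n) 1) ≠ 0 := (Metric.measure_ball_pos _ _ one_pos).ne'
  refine ⟨K * (2 ^ n * (volume (Metric.ball (0 : Euc n) 1)).toNNReal⁻¹), fun φ hφ x z => ?_⟩
  have hr := φ.rOut_pos
  have hvol : volume (Metric.closedBall (0 : Euc n) φ.rOut) =
      ENNReal.ofReal (φ.rOut ^ n) * volume (Metric.ball (0 : Euc n) 1) := by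
    rw [Measure.addHaar_closedBall _ _ hr.le, finrank_euclideanSpace_fin]
  calc ∫⁻ y, ENNReal.ofReal (φ.normed volume (y - z)) * rieszKernel x y
      ≤ ∫⁻ y, (Metric.ball z φ.rOut).indicator (fun y =>
          2 ^ n / volume (Metric.closedBall (0 : Euc n) φ.rOut) * rieszKernel x y) y := by
        refine lintegral_mono fun y => ?_
        by_cases hy : y ∈ Metric.ball z φ.rOut
        · rw [indicator_of_mem hy]
          gcongr
          have := φ.normed_le_div_measure_closedBall_rOut volume 2 hφ (y - z)
          rw [finrank_euclideanSpace_fin] at this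
          refine (ENNReal.ofReal_le_ofReal this).trans (le_of_eq ?_)
          rw [ENNReal.ofReal_div_of_pos, ENNReal.ofReal_pow (by norm_num), Measure.real,
            ENNReal.ofReal_toReal measure_closedBall_lt_top.ne]
          · simp
          · exact ENNReal.toReal_pos (Metric.measure_closedBall_pos _ _ hr).ne'
              measure_closedBall_lt_top.ne
        · have : φ.normed volume (y - z) = 0 := by
            rw [← Function.notMem_support, φ.support_normed_eq]
            simpa [dist_eq_norm] using hy
          simp [this]
    _ = 2 ^ n / volume (Metric.closedBall (0 : Euc n) φ.rOut) *
          ∫⁻ y in Metric.ball z φ.rOut, rieszKernel x y := by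
        rw [lintegral_indicator Metric.isOpen_ball.measurableSet,
          lintegral_const_mul _ (measurable_rieszKernel_right x)]
    _ ≤ 2 ^ n / volume (Metric.closedBall (0 : Euc n) φ.rOut) *
          (K * (ENNReal.ofReal (φ.rOut ^ n) * rieszKernel x z)) := by gcongr; exact hK _ _ _ hr
    _ = K * (2 ^ n * (volume (Metric.ball (0 : Euc n) 1))⁻¹) * rieszKernel x z := by
        have hro : ENNReal.ofReal (φ.rOut ^ n) ≠ 0 := by
          rw [ENNReal.ofReal_ne_zero_iff]; positivity
        rw [hvol, div_eq_mul_inv, ENNReal.mul_inv (Or.inl hro) (Or.inl ENNReal.ofReal_ne_top)]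
        have := ENNReal.inv_mul_cancel hro ENNReal.ofReal_ne_top
        calc _ = ((ENNReal.ofReal (φ.rOut ^ n))⁻¹ * ENNReal.ofReal (φ.rOut ^ n)) *
              (K * (2 ^ n * (volume (Metric.ball (0 : Euc n) 1))⁻¹) * rieszKernel x z) := by ring
          _ = _ := by rw [this, one_mul]
    _ = _ := by
        rw [ENNReal.coe_mul, ENNReal.coe_mul, ENNReal.coe_inv, ENNReal.coe_toNNReal hvtop]
        · push_cast; rfl
        · simpa [ENNReal.toNNReal_eq_zero_iff, hvtop] using hv0

/-- Integration along rays, averaged over directions in an annulus, is controlled by the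
Riesz potential. -/
theorem lintegral_rays_le {n : ℕ} (hn : 2 ≤ n) {f : Euc n → ℝ≥0∞} (hf : Measurable f)
    (x : Euc n) :
    ∫⁻ w in {w : Euc n | 1 / 4 ≤ ‖w‖ ∧ ‖w‖ ≤ 1}, ∫⁻ t in Ioi (0 : ℝ), f (x + t • w) ≤
      3 * ∫⁻ y, f y * rieszKernel x y := by
  have h2 : (2 : ℝ) ≤ n := by exact_mod_cast hn
  set S : Set (Euc n) := {w : Euc n | 1 / 4 ≤ ‖w‖ ∧ ‖w‖ ≤ 1} with hS
  have hSm : MeasurableSet S :=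
    (measurableSet_le measurable_const measurable_norm).inter
      (measurableSet_le measurable_norm measurable_const)
  have hmeas : Measurable fun p : Euc n × ℝ => f (x + p.2 • p.1) :=
    hf.comp ((measurable_snd.smul measurable_fst).const_add x)
  let T : Set (ℝ × Euc n) := {p | ‖p.2‖ ≤ p.1 ∧ p.1 ≤ 4 * ‖p.2‖}
  have hT : MeasurableSet T :=
    (measurableSet_le measurable_snd.norm measurable_fst).inter
      (measurableSet_le measurable_fst (measurable_snd.norm.const_mul 4))
  have hinner : ∀ t ∈ Ioi (0 : ℝ), ∫⁻ w in S, f (x + t • w) =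
      ∫⁻ y, ENNReal.ofReal (t ^ (-(n : ℝ))) * T.indicator (fun p => f (x + p.2)) (t, y) := by
    intro t ht
    have ht : 0 < t := ht
    have hind : Measurable fun y => T.indicator (fun p : ℝ × Euc n => f (x + p.2)) (t, y) :=
      ((hf.comp (measurable_snd.const_add x)).indicator hT).comp measurable_prodMk_left
    rw [lintegral_const_mul _ hind]
    have := lintegral_map (μ := volume) hind (measurable_const_smul t)
    rw [Measure.map_addHaar_smul _ ht.ne', lintegral_smul_measure] at this
    rw [← lintegral_indicator hSm]
    have e : ENNReal.ofReal |(t ^ Module.finrank ℝ (Euc n))⁻¹| =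
        ENNReal.ofReal (t ^ (-(n : ℝ))) := by
      rw [finrank_euclideanSpace_fin, abs_of_pos (by positivity), Real.rpow_neg ht.le,
        Real.rpow_natCast]
    rw [e, smul_eq_mul] at this
    rw [this]
    refine lintegral_congr fun w => ?_
    have hiff : w ∈ S ↔ (t, t • w) ∈ T := by
      simp only [hS, T, mem_ofPred_eq, norm_smul, Real.norm_eq_abs, abs_of_pos ht]
      constructor
      · rintro ⟨a, b⟩; constructor <;> nlinarith
      · rintro ⟨a, b⟩; constructor <;> nlinarith
    by_cases hw : w ∈ S
    · rw [indicator_of_mem hw, indicator_of_mem (hiff.1 hw)]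
    · rw [indicator_of_notMem hw, indicator_of_notMem (fun h => hw (hiff.2 h))]
  have hmeas2 : Measurable fun p : ℝ × Euc n =>
      ENNReal.ofReal (p.1 ^ (-(n : ℝ))) * T.indicator (fun p => f (x + p.2)) p :=
    ((measurable_fst.pow_const _).ennreal_ofReal).mul
      ((hf.comp (measurable_snd.const_add x)).indicator hT)
  rw [lintegral_lintegral_swap hmeas.aemeasurable, setLIntegral_congr_fun measurableSet_Ioi hinner,
    lintegral_lintegral_swap hmeas2.aemeasurable,
    ← lintegral_const_mul (f := fun y => f y * rieszKernel x y) 3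
      (hf.mul (measurable_rieszKernel_right x)),
    ← lintegral_add_left_eq_self (fun y => 3 * (f y * rieszKernel x y)) x]
  refine lintegral_mono fun y => ?_
  rcases eq_or_ne y 0 with rfl | hy
  · refine le_trans (le_of_eq ?_) zero_le
    rw [setLIntegral_congr_fun (g := fun _ => 0) measurableSet_Ioi]
    · simp
    · intro t (ht : 0 < t)
      have : (t, (0 : Euc n)) ∉ T := by
        rintro ⟨-, h⟩; simp at h; linarith
      simp [this]
  have hy0 : 0 < ‖y‖ := norm_pos_iff.2 hy
  calc ∫⁻ t in Ioi (0 : ℝ), ENNReal.ofReal (t ^ (-(n : ℝ))) *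
        T.indicator (fun p => f (x + p.2)) (t, y)
      ≤ ∫⁻ t, (Icc ‖y‖ (4 * ‖y‖)).indicator
          (fun _ => ENNReal.ofReal (‖y‖ ^ (-(n : ℝ))) * f (x + y)) t := by
        refine (setLIntegral_le_lintegral _ _).trans (lintegral_mono fun t => ?_)
        by_cases h : (t, y) ∈ T
        · rw [indicator_of_mem h, indicator_of_mem (by exact h)]
          gcongr ENNReal.ofReal ?_ * _
          exact Real.rpow_le_rpow_of_nonpos hy0 h.1 (by linarith)
        · simp [h]
    _ = 3 * (f (x + y) * rieszKernel x (x + y)) := by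
        rw [lintegral_indicator_const measurableSet_Icc, Real.volume_Icc, rieszKernel_eq_ofReal
          (by simpa using hy), dist_self_add_right]
        have e : 4 * ‖y‖ - ‖y‖ = 3 * ‖y‖ := by ring
        have e' : ENNReal.ofReal (‖y‖ ^ (1 - (n : ℝ))) =
            ENNReal.ofReal (‖y‖ ^ (-(n : ℝ))) * ENNReal.ofReal ‖y‖ := by
          rw [← ENNReal.ofReal_mul (by positivity), sub_eq_neg_add, Real.rpow_add_one hy0.ne']
        rw [e, e', ENNReal.ofReal_mul (by norm_num)]
        simp only [ENNReal.ofReal_ofNat]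
        ring

theorem sum_smul_euc_single {n : ℕ} (w : Euc n) :
    ∑ j, w j • (EuclideanSpace.single j (1 : ℝ) : Euc n) = w := by
  have := (EuclideanSpace.basisFun (Fin n) ℝ).sum_repr w
  simpa using this

theorem enorm_sum_mul_le {n : ℕ} (A : EuclideanSpace ℝ (Fin n × Fin n)) {w : Euc n}
    (hw : ‖w‖ ≤ 1) : ‖∑ i, ∑ j, w i * w j * A (i, j)‖ₑ ≤ ‖A‖ₑ := by
  rw [enorm_le_iff_norm_le]
  let W : EuclideanSpace ℝ (Fin n × Fin n) := WithLp.toLp 2 fun p => w p.1 * w p.2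
  have e : ∑ i, ∑ j, w i * w j * A (i, j) = inner ℝ A W := by
    rw [PiLp.inner_apply, Fintype.sum_prod_type]
    simp [W]
  have hW : ‖W‖ ≤ 1 := by
    have : ‖W‖ ^ 2 = (‖w‖ ^ 2) ^ 2 := by
      rw [EuclideanSpace.real_norm_sq_eq, EuclideanSpace.real_norm_sq_eq, Fintype.sum_prod_type,
        sq (∑ i, w i ^ 2), Finset.sum_mul_sum]
      simp [W, mul_pow]
    have h1 : ‖w‖ ^ 2 ≤ 1 := pow_le_one₀ (norm_nonneg _) hw
    have h2 : ‖W‖ ^ 2 ≤ 1 := this ▸ pow_le_one₀ (sq_nonneg _) h1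
    exact (sq_le_one_iff₀ (norm_nonneg _)).1 h2
  rw [e]
  exact (norm_inner_le_norm _ _).trans (mul_le_of_le_one_right (norm_nonneg _) hW)

theorem integral_sum_sum_mul {X ι : Type*} [MeasurableSpace X] [Fintype ι] {μ : Measure X}
    (c : ι → ι → ℝ) {f : ι → ι → X → ℝ} (hf : ∀ i j, Integrable (f i j) μ) :
    ∫ z, ∑ i, ∑ j, c i j * f i j z ∂μ = ∑ i, ∑ j, c i j * ∫ z, f i j z ∂μ := by
  rw [integral_finsetSum _ fun i _ => integrable_finsetSum _ fun j _ => (hf i j).const_mul _]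
  refine Finset.sum_congr rfl fun i _ => ?_
  rw [integral_finsetSum _ fun j _ => (hf i j).const_mul _]
  exact Finset.sum_congr rfl fun j _ => integral_const_mul _ _

/-- The weak formulation of the symmetric gradient, tested in a single direction. -/
theorem enorm_setIntegral_fderiv_mul_inner_le {n : ℕ} {Ω : Set (Euc n)} {u : Euc n → Euc n}
    {E : Euc n → EuclideanSpace ℝ (Fin n × Fin n)} (h : IsSymmGradOn n Ω u E)
    (hΩ : IsOpen Ω) (huint : IntegrableOn u Ω) {φ : Euc n → ℝ} (hφ : ContDiff ℝ (⊤ : ℕ∞) φ)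
    (hc : HasCompactSupport φ) (hs : tsupport φ ⊆ Ω) {w : Euc n} (hw : ‖w‖ ≤ 1) :
    ‖∫ z in Ω, fderiv ℝ φ z w * inner ℝ (u z) w‖ₑ ≤ ∫⁻ z in Ω, ‖E z‖ₑ * ‖φ z‖ₑ := by
  have hfd : Continuous (fderiv ℝ φ) := hφ.continuous_fderiv (by simp)
  have hcoord : ∀ i, IntegrableOn (fun z => u z i) Ω := fun i =>
    (EuclideanSpace.proj i : Euc n →L[ℝ] ℝ).integrable_comp huint
  have hI : ∀ i v, IntegrableOn (fun z => u z i * fderiv ℝ φ z v) Ω := by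
    intro i v
    have hcv : Continuous fun z => fderiv ℝ φ z v := hfd.clm_apply continuous_const
    have hcs : HasCompactSupport fun z => fderiv ℝ φ z v := hc.fderiv_apply ℝ v
    obtain ⟨C, hC⟩ := hcs.exists_bound_of_continuous hcv
    exact (hcoord i).mul_bdd hcv.aestronglyMeasurable (Filter.Eventually.of_forall hC)
  have hE : ∀ i j, IntegrableOn (fun z => 2 * E z (i, j) * φ z) Ω := by
    intro i j
    have h1 : IntegrableOn E (tsupport φ) := h.2.1.integrableOn_compact_subset hs hc
    have h2 : IntegrableOn (fun z => E z (i, j)) (tsupport φ) :=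
      (EuclideanSpace.proj (i, j) : EuclideanSpace ℝ (Fin n × Fin n) →L[ℝ] ℝ).integrable_comp h1
    obtain ⟨C, hC⟩ := hc.exists_bound_of_continuous hφ.continuous
    have h3 : IntegrableOn (fun z => 2 * E z (i, j) * φ z) (tsupport φ) :=
      (h2.const_mul 2).mul_bdd hφ.continuous.aestronglyMeasurable (Filter.Eventually.of_forall hC)
    refine h3.of_forall_sdiff_eq_zero hΩ.measurableSet fun z hz => ?_
    rw [image_eq_zero_of_notMem_tsupport hz.2, mul_zero]
  have hkey : 2 * ∫ z in Ω, fderiv ℝ φ z w * inner ℝ (u z) w =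
      - ∫ z in Ω, 2 * ((∑ i, ∑ j, w i * w j * E z (i, j)) * φ z) := by
    calc 2 * ∫ z in Ω, fderiv ℝ φ z w * inner ℝ (u z) w
        = ∫ z in Ω, ∑ i, ∑ j, w i * w j *
          (u z i * fderiv ℝ φ z (EuclideanSpace.single j 1)
            + u z j * fderiv ℝ φ z (EuclideanSpace.single i 1)) := by
          rw [← integral_const_mul]
          refine integral_congr_ae (Filter.Eventually.of_forall fun z => ?_)
          have e1 : fderiv ℝ φ z w = ∑ j, w j * fderiv ℝ φ z (EuclideanSpace.single j 1) := by
            conv_lhs => rw [← sum_smul_euc_single w]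
            simp
          have e2 : inner ℝ (u z) w = ∑ i, w i * u z i := by
            rw [PiLp.inner_apply]; simp
          have e3 : fderiv ℝ φ z w * inner ℝ (u z) w = ∑ i, ∑ j, w i * w j *
              (u z i * fderiv ℝ φ z (EuclideanSpace.single j 1)) := by
            rw [mul_comm, e1, e2, Finset.sum_mul_sum]
            exact Finset.sum_congr rfl fun i _ => Finset.sum_congr rfl fun j _ => by ring
          have e4 : fderiv ℝ φ z w * inner ℝ (u z) w = ∑ i, ∑ j, w i * w j *
              (u z j * fderiv ℝ φ z (EuclideanSpace.single i 1)) := by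
            rw [e1, e2, Finset.sum_mul_sum]
            exact Finset.sum_congr rfl fun i _ => Finset.sum_congr rfl fun j _ => by ring
          simp only [mul_add, Finset.sum_add_distrib]
          rw [← e3, ← e4]; ring
      _ = ∑ i, ∑ j, w i * w j * ∫ z in Ω, (u z i * fderiv ℝ φ z (EuclideanSpace.single j 1)
            + u z j * fderiv ℝ φ z (EuclideanSpace.single i 1)) := by
          exact integral_sum_sum_mul _ fun i j => (hI _ _).add (hI _ _)
      _ = - ∑ i, ∑ j, w i * w j * ∫ z in Ω, 2 * E z (i, j) * φ z := by
          simp_rw [h.2.2 φ hφ hc hs, mul_neg, Finset.sum_neg_distrib]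
      _ = - ∫ z in Ω, ∑ i, ∑ j, w i * w j * (2 * E z (i, j) * φ z) := by
          rw [integral_sum_sum_mul _ hE]
      _ = _ := by
          congr 1
          refine integral_congr_ae (Filter.Eventually.of_forall fun z => ?_)
          simp only [Finset.sum_mul, Finset.mul_sum]
          exact Finset.sum_congr rfl fun i _ => Finset.sum_congr rfl fun j _ => by ring
  have hkey' : ∫ z in Ω, fderiv ℝ φ z w * inner ℝ (u z) w =
      - ∫ z in Ω, (∑ i, ∑ j, w i * w j * E z (i, j)) * φ z := by
    rw [integral_const_mul] at hkey
    linarith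
  rw [hkey', enorm_neg]
  refine (enorm_integral_le_lintegral_enorm _).trans (lintegral_mono fun z => ?_)
  rw [enorm_mul]
  gcongr
  exact enorm_sum_mul_le _ hw

/-- Mollification along a line is differentiable, with the expected continuous derivative. -/
theorem hasDerivAt_mollify_line {n : ℕ} {ν : Measure (Euc n)} {g ρ : Euc n → ℝ}
    (hg : Integrable g ν) (hρ : ContDiff ℝ (⊤ : ℕ∞) ρ) (hc : HasCompactSupport ρ) (x w : Euc n) :
    (∀ t : ℝ, HasDerivAt (fun t : ℝ => ∫ z, ρ (x + t • w - z) * g z ∂ν)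
      (∫ z, fderiv ℝ ρ (x + t • w - z) w * g z ∂ν) t) ∧
    Continuous fun t : ℝ => ∫ z, fderiv ℝ ρ (x + t • w - z) w * g z ∂ν := by
  have hfd : Continuous fun y => fderiv ℝ ρ y w :=
    (hρ.continuous_fderiv (by simp)).clm_apply continuous_const
  obtain ⟨C, hC⟩ := (hc.fderiv_apply ℝ w).exists_bound_of_continuous hfd
  obtain ⟨C', hC'⟩ := hc.exists_bound_of_continuous hρ.continuous
  have hm : ∀ t : ℝ, AEStronglyMeasurable (fun z => fderiv ℝ ρ (x + t • w - z) w * g z) ν :=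
    fun t => (hfd.comp (by fun_prop)).aestronglyMeasurable.mul hg.aestronglyMeasurable
  have hb : ∀ (t : ℝ) z, ‖fderiv ℝ ρ (x + t • w - z) w * g z‖ ≤ C * ‖g z‖ := fun t z => by
    rw [norm_mul]; gcongr; exact hC _
  refine ⟨fun t => ?_, ?_⟩
  · refine (hasDerivAt_integral_of_dominated_loc_of_deriv_le (s := univ)
      (bound := fun z => C * ‖g z‖) Filter.univ_mem
      (Filter.Eventually.of_forall fun t => ?_) ?_ (hm t)
      (Filter.Eventually.of_forall fun z t _ => hb t z) (hg.norm.const_mul C)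
      (Filter.Eventually.of_forall fun z t _ => ?_)).2
    · exact (hρ.continuous.comp (by fun_prop)).aestronglyMeasurable.mul hg.aestronglyMeasurable
    · exact hg.bdd_mul (hρ.continuous.comp (by fun_prop)).aestronglyMeasurable
        (Filter.Eventually.of_forall fun z => hC' _)
    · have h1 : HasDerivAt (fun t : ℝ => x + t • w - z) w t := by
        simpa using (((hasDerivAt_id t).smul_const w).const_add x).sub_const z
      have h2 : HasFDerivAt ρ (fderiv ℝ ρ (x + t • w - z)) (x + t • w - z) :=
        (hρ.differentiable (by simp) _).hasFDerivAt
      exact (h2.comp_hasDerivAt t h1).mul_const _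
  · refine continuous_of_dominated hm (fun t => Filter.Eventually.of_forall (hb t))
      (hg.norm.const_mul C) (Filter.Eventually.of_forall fun z => ?_)
    exact (hfd.comp (by fun_prop)).mul continuous_const

/-- The mollification of `‖E‖` over `Ω`. -/
def mollifiedNorm {n : ℕ} (Ω : Set (Euc n)) (E : Euc n → EuclideanSpace ℝ (Fin n × Fin n))
    (φ : ContDiffBump (0 : Euc n)) (y : Euc n) : ℝ≥0∞ :=
  ∫⁻ z in Ω, ‖E z‖ₑ * ENNReal.ofReal (φ.normed volume (y - z))

/-- Fundamental theorem of calculus along a segment for the mollified field. -/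
theorem enorm_mollify_le {n : ℕ} {Ω : Set (Euc n)} {u : Euc n → Euc n}
    {E : Euc n → EuclideanSpace ℝ (Fin n × Fin n)} (h : IsSymmGradOn n Ω u E)
    (hΩ : IsOpen Ω) (huint : IntegrableOn u Ω) (φ : ContDiffBump (0 : Euc n)) {x w : Euc n}
    (hw : ‖w‖ ≤ 1) {T : ℝ} (hT : 0 ≤ T)
    (hseg : ∀ t ∈ Icc (0 : ℝ) T, Metric.closedBall (x + t • w) φ.rOut ⊆ Ω) :
    ‖∫ z in Ω, φ.normed volume (x - z) * inner ℝ (u z) w‖ₑ ≤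
      ‖∫ z in Ω, φ.normed volume (x + T • w - z) * inner ℝ (u z) w‖ₑ +
        ∫⁻ t in Ioi (0 : ℝ), mollifiedNorm Ω E φ (x + t • w) := by
  set ρ := φ.normed volume with hρd
  have hρ : ContDiff ℝ (⊤ : ℕ∞) ρ := φ.contDiff_normed
  have hc : HasCompactSupport ρ := φ.hasCompactSupport_normed
  have hg : IntegrableOn (fun z => inner ℝ (u z) w) Ω := huint.inner_const w
  obtain ⟨hd, hcont⟩ := hasDerivAt_mollify_line hg hρ hc x w
  have hftc := intervalIntegral.integral_eq_sub_of_hasDerivAt (a := 0) (b := T)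
    (fun t _ => hd t) (hcont.intervalIntegrable _ _)
  simp only [zero_smul, add_zero] at hftc
  have hbd : ∀ t ∈ Ioc (0 : ℝ) T, ‖∫ z in Ω, fderiv ℝ ρ (x + t • w - z) w * inner ℝ (u z) w‖ₑ ≤
      mollifiedNorm Ω E φ (x + t • w) := by
    intro t ht
    set y := x + t • w with hy
    have e : ∀ z, fderiv ℝ (fun z => ρ (y - z)) z w = - fderiv ℝ ρ (y - z) w := by
      intro z
      have h1 : HasFDerivAt (fun z => y - z) (-ContinuousLinearMap.id ℝ (Euc n)) z :=
        (hasFDerivAt_id z).const_sub y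
      have h2 : HasFDerivAt ρ (fderiv ℝ ρ (y - z)) (y - z) :=
        (hρ.differentiable (by simp) _).hasFDerivAt
      have h3 : HasFDerivAt (fun z => ρ (y - z)) _ z := h2.comp z h1
      rw [h3.fderiv]
      simp
    have hsupp : Function.support (fun z => ρ (y - z)) ⊆ Metric.closedBall y φ.rOut := by
      intro z hz
      have : y - z ∈ Metric.ball (0 : Euc n) φ.rOut := by
        rw [← φ.support_normed_eq (μ := volume)]; exact hz
      rw [Metric.mem_closedBall, dist_comm, dist_eq_norm]
      exact (mem_ball_zero_iff.1 this).le
    have hts : tsupport (fun z => ρ (y - z)) ⊆ Metric.closedBall y φ.rOut :=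
      closure_minimal hsupp Metric.isClosed_closedBall
    have := enorm_setIntegral_fderiv_mul_inner_le h hΩ huint (φ := fun z => ρ (y - z))
      (hρ.comp (contDiff_const.sub contDiff_id))
      (HasCompactSupport.of_support_subset_isCompact (isCompact_closedBall y φ.rOut) hsupp)
      (hts.trans (hseg t (Ioc_subset_Icc_self ht))) hw
    simp only [e, neg_mul, integral_neg, enorm_neg] at this
    refine this.trans (le_of_eq ?_)
    refine lintegral_congr fun z => ?_
    rw [Real.enorm_of_nonneg (φ.nonneg_normed _)]
  have e0 : (∫ z in Ω, ρ (x - z) * inner ℝ (u z) w) =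
      (∫ z in Ω, ρ (x + T • w - z) * inner ℝ (u z) w) -
        ∫ t in (0 : ℝ)..T, ∫ z in Ω, fderiv ℝ ρ (x + t • w - z) w * inner ℝ (u z) w := by
    rw [hftc]; ring
  rw [e0]
  refine (enorm_sub_le).trans (add_le_add le_rfl ?_)
  rw [intervalIntegral.integral_of_le hT]
  refine (enorm_integral_le_lintegral_enorm _).trans ?_
  exact (setLIntegral_mono' measurableSet_Ioc hbd).trans
    (lintegral_mono_set Ioc_subset_Ioi_self)

theorem tendsto_setIntegral_normed_mul {n : ℕ} {Ω : Set (Euc n)} {g : Euc n → ℝ}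
    (hΩ : IsOpen Ω) (hg : ContinuousOn g Ω) {φ : ℕ → ContDiffBump (0 : Euc n)}
    (hφ : Filter.Tendsto (fun j => (φ j).rOut) Filter.atTop (nhds 0)) {y : Euc n} (hy : y ∈ Ω) :
    Filter.Tendsto (fun j => ∫ z in Ω, (φ j).normed volume (y - z) * g z) Filter.atTop
      (nhds (g y)) := by
  have hgy : ContinuousAt (Ω.indicator g) y := by
    refine (hg.continuousAt (hΩ.mem_nhds hy)).congr ?_
    filter_upwards [hΩ.mem_nhds hy] with z hz using (indicator_of_mem hz g).symm
  have hm : AEStronglyMeasurable (Ω.indicator g) volume :=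
    (aestronglyMeasurable_indicator_iff hΩ.measurableSet).2
      (hg.aestronglyMeasurable hΩ.measurableSet)
  have := ContDiffBump.convolution_tendsto_right (μ := volume) (φ := φ) (g := fun _ => Ω.indicator g)
    (k := fun _ => y) (x₀ := y) (z₀ := g y) hφ (Filter.Eventually.of_forall fun _ => hm)
    (by
      have h := hgy.tendsto.comp (Filter.tendsto_snd (f := (Filter.atTop : Filter ℕ)))
      rw [indicator_of_mem hy] at h
      exact h) tendsto_const_nhds
  refine this.congr fun j => ?_
  rw [convolution_lsmul_swap, ← integral_indicator hΩ.measurableSet]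
  refine integral_congr_ae (Filter.Eventually.of_forall fun z => ?_)
  by_cases hz : z ∈ Ω <;> simp [hz]

theorem enorm_inner_le {n : ℕ} {v w : Euc n} (hw : ‖w‖ ≤ 1) :
    ‖(inner ℝ v w : ℝ)‖ₑ ≤ ‖v‖ₑ := by
  rw [← ofReal_norm, ← ofReal_norm]
  exact ENNReal.ofReal_le_ofReal
    ((norm_inner_le_norm _ _).trans (mul_le_of_le_one_right (norm_nonneg _) hw))

theorem enorm_inner_le_add_liminf {n : ℕ} {Ω : Set (Euc n)} {u : Euc n → Euc n}
    {E : Euc n → EuclideanSpace ℝ (Fin n × Fin n)} (h : IsSymmGradOn n Ω u E)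
    (hΩ : IsOpen Ω) (huint : IntegrableOn u Ω) (hu : ContinuousOn u Ω)
    {φ : ℕ → ContDiffBump (0 : Euc n)}
    (hφ : Filter.Tendsto (fun j => (φ j).rOut) Filter.atTop (nhds 0)) {x w : Euc n}
    (hw : ‖w‖ ≤ 1) {T : ℝ} (hT : 0 ≤ T) (hseg : ∀ t ∈ Icc (0 : ℝ) T, x + t • w ∈ Ω) :
    ‖(inner ℝ (u x) w : ℝ)‖ₑ ≤ ‖u (x + T • w)‖ₑ +
      Filter.liminf (fun j => ∫⁻ t in Ioi (0 : ℝ), mollifiedNorm Ω E (φ j) (x + t • w))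
        Filter.atTop := by
  have hx : x ∈ Ω := by simpa using hseg 0 (left_mem_Icc.2 hT)
  have hxT : x + T • w ∈ Ω := hseg T (right_mem_Icc.2 hT)
  have hgc : ContinuousOn (fun z => inner ℝ (u z) w) Ω := hu.inner continuousOn_const
  have hK : IsCompact ((fun t : ℝ => x + t • w) '' Icc 0 T) :=
    isCompact_Icc.image (by fun_prop)
  have hsub : (fun t : ℝ => x + t • w) '' Icc 0 T ⊆ Ω := by
    rintro _ ⟨t, ht, rfl⟩; exact hseg t ht
  obtain ⟨δ, hδ, hδs⟩ := hK.exists_cthickening_subset_open hΩ hsub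
  have hsmall : ∀ᶠ j in Filter.atTop, (φ j).rOut < δ := hφ.eventually_lt_const hδ
  have hlim : Filter.Tendsto (fun j =>
      ‖∫ z in Ω, (φ j).normed volume (x - z) * inner ℝ (u z) w‖ₑ -
      ‖∫ z in Ω, (φ j).normed volume (x + T • w - z) * inner ℝ (u z) w‖ₑ) Filter.atTop
      (nhds (‖(inner ℝ (u x) w : ℝ)‖ₑ - ‖(inner ℝ (u (x + T • w)) w : ℝ)‖ₑ)) :=
    ENNReal.Tendsto.sub (tendsto_setIntegral_normed_mul hΩ hgc hφ hx).enorm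
      (tendsto_setIntegral_normed_mul hΩ hgc hφ hxT).enorm (Or.inl enorm_ne_top)
  have hle : ‖(inner ℝ (u x) w : ℝ)‖ₑ - ‖(inner ℝ (u (x + T • w)) w : ℝ)‖ₑ ≤
      Filter.liminf (fun j => ∫⁻ t in Ioi (0 : ℝ), mollifiedNorm Ω E (φ j) (x + t • w))
        Filter.atTop := by
    rw [← hlim.liminf_eq]
    refine Filter.liminf_le_liminf ?_
    filter_upwards [hsmall] with j hj
    rw [tsub_le_iff_left]
    refine enorm_mollify_le h hΩ huint (φ j) hw hT fun t ht => ?_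
    have hm : x + t • w ∈ (fun t : ℝ => x + t • w) '' Icc 0 T := ⟨t, ht, rfl⟩
    exact (Metric.closedBall_subset_cthickening hm (φ j).rOut).trans
      ((Metric.cthickening_mono hj.le _).trans hδs)
  rw [tsub_le_iff_left] at hle
  refine hle.trans (add_le_add ?_ le_rfl)
  exact enorm_inner_le hw

theorem MemCb.exists_bound {n : ℕ} {Ω : Set (Euc n)} {u : Euc n → Euc n} (hu : MemCb n Ω u) :
    ∃ A : ℝ≥0, ∀ y ∈ closure Ω, ‖u y‖ₑ ≤ A := by
  obtain ⟨hc, hb⟩ := hu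
  obtain ⟨R, hR⟩ := hb.subset_closedBall 0
  obtain ⟨A, hA⟩ := ((isCompact_closedBall (0 : Euc n) R).inter_left
    isClosed_closure).exists_bound_of_continuousOn (hc.mono inter_subset_left)
  refine ⟨A.toNNReal, fun y hy => ?_⟩
  rw [← ofReal_norm, ENNReal.ofReal]
  refine ENNReal.coe_le_coe.2 ?_
  by_cases h0 : u y = 0
  · simp [h0]
  · exact Real.toNNReal_le_toNNReal (hA y ⟨hy, hR ⟨hy, h0⟩⟩)

theorem MemCb.exists_eq_zero {n : ℕ} {Ω : Set (Euc n)} {u : Euc n → Euc n} (hu : MemCb n Ω u) :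
    ∃ R : ℝ, ∀ y ∈ closure Ω, R < ‖y‖ → u y = 0 := by
  obtain ⟨R, hR⟩ := hu.2.subset_closedBall 0
  refine ⟨R, fun y hy h => ?_⟩
  by_contra h0
  exact absurd (mem_closedBall_zero_iff.1 (hR ⟨hy, h0⟩)) (not_le.2 h)

theorem MemCb.integrableOn {n : ℕ} {Ω : Set (Euc n)} {u : Euc n → Euc n} (hu : MemCb n Ω u)
    (hΩ : IsOpen Ω) : IntegrableOn u Ω := by
  obtain ⟨R, hR⟩ := hu.2.subset_closedBall 0
  have hK : IsCompact (closure Ω ∩ Metric.closedBall (0 : Euc n) R) :=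
    (isCompact_closedBall _ _).inter_left isClosed_closure
  have h1 : IntegrableOn u (Ω ∩ Metric.closedBall (0 : Euc n) R) :=
    ((hu.1.mono inter_subset_left).integrableOn_compact hK).mono_set
      (inter_subset_inter_left _ subset_closure)
  refine h1.of_forall_sdiff_eq_zero hΩ.measurableSet fun x hx => ?_
  by_contra h0
  exact hx.2 ⟨hx.1, hR ⟨subset_closure hx.1, h0⟩⟩

/-- The first exit point of a ray which leaves an open set. -/
theorem exists_first_exit {n : ℕ} {Ω : Set (Euc n)} (hΩ : IsOpen Ω) {x w : Euc n} (hx : x ∈ Ω)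
    (hex : ∃ t : ℝ, 0 ≤ t ∧ x + t • w ∉ Ω) :
    ∃ t : ℝ, 0 < t ∧ x + t • w ∈ frontier Ω ∧ ∀ s ∈ Ico 0 t, x + s • w ∈ Ω := by
  set S : Set ℝ := {t | 0 ≤ t ∧ x + t • w ∉ Ω} with hS
  have hcont : Continuous fun t : ℝ => x + t • w := by fun_prop
  have hcl : IsClosed S :=
    isClosed_Ici.inter ((hΩ.preimage hcont).isClosed_compl)
  have hbdd : BddBelow S := ⟨0, fun t ht => ht.1⟩
  have hmem : sInf S ∈ S := hcl.csInf_mem hex hbdd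
  have hbelow : ∀ s ∈ Ico 0 (sInf S), x + s • w ∈ Ω := by
    intro s hs
    by_contra h
    exact absurd (csInf_le hbdd (show s ∈ S from ⟨hs.1, h⟩)) (not_le.2 hs.2)
  have hpos : 0 < sInf S := by
    refine lt_of_le_of_ne hmem.1 fun h => hmem.2 ?_
    rw [← h]; simpa using hx
  refine ⟨sInf S, hpos, ?_, hbelow⟩
  rw [hΩ.frontier_eq]
  refine ⟨?_, hmem.2⟩
  have : sInf S ∈ closure (Ico 0 (sInf S)) := by
    rw [closure_Ico hpos.ne]; exact right_mem_Icc.2 hpos.le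
  exact map_mem_closure (f := fun t : ℝ => x + t • w) hcont this hbelow

theorem le_lintegral_ray_ball {n : ℕ} {x w y : Euc n} {r t : ℝ} (hw : ‖w‖ ≤ 1)
    (ht : 0 < t) (hb : x + t • w ∈ Metric.ball y r) :
    ENNReal.ofReal r ≤
      ∫⁻ t in Ioi (0 : ℝ), (Metric.ball y (2 * r)).indicator (fun _ => 1) (x + t • w) := by
  calc ENNReal.ofReal r = ∫⁻ s in Ioo t (t + r), 1 := by simp
    _ ≤ ∫⁻ s in Ioo t (t + r), (Metric.ball y (2 * r)).indicator (fun _ => 1) (x + s • w) := by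
        refine setLIntegral_mono' measurableSet_Ioo fun s hs => ?_
        rw [indicator_of_mem]
        rw [Metric.mem_ball] at hb ⊢
        have h1 : dist (x + s • w) (x + t • w) ≤ r := by
          rw [dist_add_left, dist_eq_norm, ← sub_smul, norm_smul, Real.norm_of_nonneg
            (by linarith [hs.1])]
          nlinarith [hs.1, hs.2, norm_nonneg w]
        linarith [dist_triangle (x + s • w) (x + t • w) y]
    _ ≤ _ := lintegral_mono_set fun s hs => ht.trans hs.1

/-- Estimate for `u` along a ray, in terms of its boundary values and the mollified symmetric
gradient. -/
theorem enorm_inner_le_ray {n : ℕ} {Ω : Set (Euc n)} {u : Euc n → Euc n}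
    {E : Euc n → EuclideanSpace ℝ (Fin n × Fin n)} (h : IsSymmGradOn n Ω u E)
    (hΩ : IsOpen Ω) (hu : MemCb n Ω u) {φ : ℕ → ContDiffBump (0 : Euc n)}
    (hφ : Filter.Tendsto (fun j => (φ j).rOut) Filter.atTop (nhds 0))
    {ι : Type*} {c : ℝ≥0∞} {a : ι → ℝ≥0∞} {y : ι → Euc n} {r : ι → ℝ} (hr : ∀ i, 0 < r i)
    (hcov : ∀ z ∈ frontier Ω, ‖u z‖ₑ ≤ c ∨ ∃ i, z ∈ Metric.ball (y i) (r i) ∧ ‖u z‖ₑ ≤ a i)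
    {x w : Euc n} (hx : x ∈ Ω) (hw : ‖w‖ ≤ 1) (hw0 : w ≠ 0) :
    ‖(inner ℝ (u x) w : ℝ)‖ₑ ≤ c + ∑' i, a i / ENNReal.ofReal (r i) *
        (∫⁻ t in Ioi (0 : ℝ), (Metric.ball (y i) (2 * r i)).indicator (fun _ => 1) (x + t • w)) +
      Filter.liminf (fun j => ∫⁻ t in Ioi (0 : ℝ), mollifiedNorm Ω E (φ j) (x + t • w))
        Filter.atTop := by
  have key := fun T hT hs => enorm_inner_le_add_liminf (T := T) h hΩ (hu.integrableOn hΩ)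
    (hu.1.mono subset_closure) hφ hw hT hs (x := x)
  by_cases hex : ∃ t : ℝ, 0 ≤ t ∧ x + t • w ∉ Ω
  · obtain ⟨t, ht, hfr, hin⟩ := exists_first_exit hΩ hx hex
    have hcl : x + t • w ∈ closure Ω := frontier_subset_closure hfr
    have hlim : Filter.Tendsto (fun T : ℝ => ‖u (x + T • w)‖ₑ) (nhdsWithin t (Ico 0 t))
        (nhds ‖u (x + t • w)‖ₑ) := by
      refine Filter.Tendsto.enorm ?_
      refine Filter.Tendsto.comp (hu.1 _ hcl) ?_
      refine tendsto_nhdsWithin_iff.2 ⟨?_, ?_⟩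
      · exact (Continuous.tendsto (by fun_prop) t).mono_left nhdsWithin_le_nhds
      · filter_upwards [self_mem_nhdsWithin] with s hs using subset_closure (hin s hs)
    have hne : (nhdsWithin t (Ico 0 t)).NeBot := by
      rw [← mem_closure_iff_nhdsWithin_neBot, closure_Ico ht.ne]
      exact right_mem_Icc.2 ht.le
    have hle : ‖(inner ℝ (u x) w : ℝ)‖ₑ ≤ ‖u (x + t • w)‖ₑ +
        Filter.liminf (fun j => ∫⁻ t in Ioi (0 : ℝ), mollifiedNorm Ω E (φ j) (x + t • w))
          Filter.atTop := by
      refine ge_of_tendsto (hlim.add_const _) ?_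
      filter_upwards [self_mem_nhdsWithin] with s hs
      exact key s hs.1 fun s' hs' => hin s' ⟨hs'.1, hs'.2.trans_lt hs.2⟩
    refine hle.trans (add_le_add ?_ le_rfl)
    rcases hcov _ hfr with h1 | ⟨i, hi, h1⟩
    · exact h1.trans le_self_add
    · refine h1.trans (le_trans ?_ le_add_self)
      refine le_trans ?_ (ENNReal.le_tsum i)
      have hri : ENNReal.ofReal (r i) ≠ 0 := by simpa using hr i
      calc a i = a i / ENNReal.ofReal (r i) * ENNReal.ofReal (r i) :=
            (ENNReal.div_mul_cancel hri ENNReal.ofReal_ne_top).symm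
        _ ≤ _ := by
            gcongr
            exact le_lintegral_ray_ball hw ht hi
  · push Not at hex
    obtain ⟨R, hR⟩ := hu.exists_eq_zero
    set T := (|R| + ‖x‖ + 1) / ‖w‖ with hT
    have hwp : 0 < ‖w‖ := norm_pos_iff.2 hw0
    have hT0 : 0 ≤ T := by positivity
    have h0 : u (x + T • w) = 0 := by
      refine hR _ (subset_closure (hex T hT0)) ?_
      have h1 : ‖T • w‖ = |R| + ‖x‖ + 1 := by
        rw [norm_smul, Real.norm_of_nonneg hT0, hT, div_mul_cancel₀ _ hwp.ne']
      have h2 : ‖T • w‖ ≤ ‖x + T • w‖ + ‖x‖ := by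
        have := norm_sub_le (x + T • w) x
        rwa [add_sub_cancel_left] at this
      linarith [le_abs_self R]
    have := key T hT0 fun t ht => hex t ht.1
    rw [h0, enorm_zero, zero_add] at this
    exact this.trans le_add_self

theorem lintegral_mollifiedNorm_mul_le {n : ℕ} {K : ℝ≥0} {φ : ContDiffBump (0 : Euc n)}
    (hK : ∀ x z : Euc n, ∫⁻ y, ENNReal.ofReal (φ.normed volume (y - z)) * rieszKernel x y ≤
      K * rieszKernel x z) {Ω : Set (Euc n)} {E : Euc n → EuclideanSpace ℝ (Fin n × Fin n)}
    (hE : AEStronglyMeasurable E (volume.restrict Ω)) :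
    Measurable (mollifiedNorm Ω E φ) ∧ ∀ x, ∫⁻ y, mollifiedNorm Ω E φ y * rieszKernel x y ≤
      K * ∫⁻ z in Ω, ‖E z‖ₑ * rieszKernel x z := by
  obtain ⟨f, hf, hfe⟩ := hE.enorm
  have e : ∀ g : Euc n → ℝ≥0∞, ∫⁻ z in Ω, ‖E z‖ₑ * g z = ∫⁻ z in Ω, f z * g z := fun g =>
    lintegral_congr_ae (by filter_upwards [hfe] with z hz; rw [hz])
  have hφm : Measurable fun y : Euc n => ENNReal.ofReal (φ.normed volume y) :=
    ENNReal.measurable_ofReal.comp φ.continuous_normed.measurable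
  have hφ2 : Measurable fun p : Euc n × Euc n =>
      ENNReal.ofReal (φ.normed volume (p.1 - p.2)) := hφm.comp (by fun_prop)
  have hM : mollifiedNorm Ω E φ =
      fun y => ∫⁻ z in Ω, f z * ENNReal.ofReal (φ.normed volume (y - z)) :=
    funext fun y => e _
  have hm2 : Measurable fun p : Euc n × Euc n =>
      f p.2 * ENNReal.ofReal (φ.normed volume (p.1 - p.2)) := (hf.comp measurable_snd).mul hφ2
  refine ⟨hM ▸ hm2.lintegral_prod_right', fun x => ?_⟩
  rw [e, hM]
  have hk : Measurable fun y => rieszKernel x y := measurable_rieszKernel_right x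
  calc ∫⁻ y, (∫⁻ z in Ω, f z * ENNReal.ofReal (φ.normed volume (y - z))) * rieszKernel x y
      = ∫⁻ y, ∫⁻ z in Ω, f z * ENNReal.ofReal (φ.normed volume (y - z)) * rieszKernel x y := by
        refine lintegral_congr fun y => (lintegral_mul_const _ ?_).symm
        exact hm2.comp measurable_prodMk_left
    _ = ∫⁻ z in Ω, ∫⁻ y, f z * ENNReal.ofReal (φ.normed volume (y - z)) * rieszKernel x y :=
        lintegral_lintegral_swap (hm2.mul (hk.comp measurable_fst)).aemeasurable
    _ ≤ ∫⁻ z in Ω, K * (f z * rieszKernel x z) := by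
        refine lintegral_mono fun z => ?_
        simp_rw [mul_assoc]
        have h1 : Measurable fun y =>
            ENNReal.ofReal (φ.normed volume (y - z)) * rieszKernel x y :=
          (hφ2.comp measurable_prodMk_right).mul hk
        rw [lintegral_const_mul _ h1]
        calc f z * _ ≤ f z * (K * rieszKernel x z) := by gcongr; exact hK x z
          _ = _ := by ring
    _ = K * ∫⁻ z in Ω, f z * rieszKernel x z := lintegral_const_mul _ (hf.mul hk)

theorem exists_contDiffBump_seq (n : ℕ) : ∃ φ : ℕ → ContDiffBump (0 : Euc n),
    (∀ j, (φ j).rOut ≤ 2 * (φ j).rIn) ∧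
      Filter.Tendsto (fun j => (φ j).rOut) Filter.atTop (nhds 0) := by
  have hpos : ∀ j : ℕ, (0 : ℝ) < 1 / ((j : ℝ) + 1) := fun j => by positivity
  refine ⟨fun j => ⟨1 / ((j : ℝ) + 1) / 2, 1 / ((j : ℝ) + 1), by have := hpos j; positivity,
    half_lt_self (hpos j)⟩, fun j => ?_, tendsto_one_div_add_atTop_nhds_zero_nat⟩
  show 1 / ((j : ℝ) + 1) ≤ 2 * (1 / ((j : ℝ) + 1) / 2)
  linarith

theorem inner_lower_bound {n : ℕ} {v w : Euc n} (hv : v ≠ 0)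
    (hw : w ∈ Metric.ball ((2 * ‖v‖)⁻¹ • v) (1 / 4)) :
    1 / 4 ≤ ‖w‖ ∧ ‖w‖ ≤ 1 ∧ ‖v‖ₑ ≤ 4 * ‖(inner ℝ v w : ℝ)‖ₑ := by
  have hvp : 0 < ‖v‖ := norm_pos_iff.2 hv
  set c := (2 * ‖v‖)⁻¹ • v with hc
  have hcn : ‖c‖ = 1 / 2 := by
    rw [hc, norm_smul, Real.norm_of_nonneg (by positivity)]; field_simp
  rw [mem_ball_iff_norm] at hw
  have h1 : ‖c‖ ≤ ‖w - c‖ + ‖w‖ := by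
    have := norm_sub_le w (w - c)
    rw [sub_sub_cancel] at this; linarith
  have h2 : ‖w‖ ≤ ‖w - c‖ + ‖c‖ := by
    have := norm_add_le (w - c) c
    rwa [sub_add_cancel] at this
  refine ⟨by linarith, by linarith, ?_⟩
  have h3 : inner ℝ v c = ‖v‖ / 2 := by
    rw [hc, real_inner_smul_right, real_inner_self_eq_norm_sq]; field_simp
  have h4 : |(inner ℝ v (w - c) : ℝ)| ≤ ‖v‖ / 4 := by
    refine (abs_real_inner_le_norm _ _).trans ?_
    nlinarith
  have h5 : (inner ℝ v w : ℝ) = inner ℝ v c + inner ℝ v (w - c) := by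
    rw [← inner_add_right, add_sub_cancel]
  have h6 : ‖v‖ ≤ 4 * |(inner ℝ v w : ℝ)| := by
    have := (abs_le.1 h4).1
    have := le_abs_self (inner ℝ v w : ℝ)
    linarith
  rw [← ofReal_norm, ← ofReal_norm, Real.norm_eq_abs,
    show (4 : ℝ≥0∞) = ENNReal.ofReal 4 by simp, ← ENNReal.ofReal_mul (by norm_num)]
  exact ENNReal.ofReal_le_ofReal h6

/-- Pointwise estimate of `u` by the Riesz potential of order one of its symmetric gradient and
its boundary values, controlled by a countable family of balls. -/
theorem exists_enorm_le_potential (n : ℕ) (hn : 2 ≤ n) : ∃ C : ℝ≥0,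
    ∀ (Ω : Set (Euc n)) (u : Euc n → Euc n) (E : Euc n → EuclideanSpace ℝ (Fin n × Fin n)),
      IsSymmGradOn n Ω u E → IsOpen Ω → MemCb n Ω u →
    ∀ (ι : Type) [Countable ι] (c : ℝ≥0∞) (a : ι → ℝ≥0∞) (y : ι → Euc n) (r : ι → ℝ),
      (∀ i, 0 < r i) →
      (∀ z ∈ frontier Ω, ‖u z‖ₑ ≤ c ∨ ∃ i, z ∈ Metric.ball (y i) (r i) ∧ ‖u z‖ₑ ≤ a i) →
    ∀ x ∈ Ω, ‖u x‖ₑ ≤ C * (c + ∑' i, a i * ENNReal.ofReal (r i ^ ((n : ℝ) - 1)) *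
      rieszKernel x (y i) + ∫⁻ z in Ω, ‖E z‖ₑ * rieszKernel x z) := by
  obtain ⟨K₁, hK₁⟩ := exists_setLIntegral_ball_rieszKernel_le n hn
  obtain ⟨K₂, hK₂⟩ := exists_lintegral_normed_mul_rieszKernel_le n hn
  obtain ⟨φ, hφ₁, hφ₂⟩ := exists_contDiffBump_seq n
  set V : ℝ≥0∞ := volume (Metric.ball (0 : Euc n) (1 / 4)) with hV
  have hV0 : V ≠ 0 := (Metric.measure_ball_pos volume _ (by norm_num)).ne'
  have hVt : V ≠ ⊤ := measure_ball_lt_top.ne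
  set D : ℝ≥0∞ := 4 * V⁻¹ * (V + 3 * (K₁ * 2 ^ n) + 3 * K₂) with hD
  have hDt : D ≠ ⊤ := by
    have : V⁻¹ ≠ ⊤ := ENNReal.inv_ne_top.2 hV0
    rw [hD]
    finiteness
  refine ⟨D.toNNReal, ?_⟩
  rw [ENNReal.coe_toNNReal hDt]
  intro Ω u E h hΩ hu ι _ c a y r hr hcov x hx
  by_cases hv : u x = 0
  · simp [hv]
  have hE : AEStronglyMeasurable E (volume.restrict Ω) := h.2.1.aestronglyMeasurable
  set B := Metric.ball ((2 * ‖u x‖)⁻¹ • u x) (1 / 4) with hB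
  have hVB : volume B = V := by rw [hB, hV, Measure.addHaar_ball_center]
  have hBsub : B ⊆ {w | 1 / 4 ≤ ‖w‖ ∧ ‖w‖ ≤ 1} := fun w hw =>
    ⟨(inner_lower_bound hv hw).1, (inner_lower_bound hv hw).2.1⟩
  have hmol := fun j => lintegral_mollifiedNorm_mul_le (hK₂ (φ j) (hφ₁ j)) hE
  have hrm : ∀ f : Euc n → ℝ≥0∞, Measurable f →
      Measurable fun w : Euc n => ∫⁻ t in Ioi (0 : ℝ), f (x + t • w) := fun f hf =>
    Measurable.lintegral_prod_right' (f := fun p : Euc n × ℝ => f (x + p.2 • p.1))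
      (hf.comp (by fun_prop))
  have hrays : ∀ f : Euc n → ℝ≥0∞, Measurable f →
      ∫⁻ w in B, ∫⁻ t in Ioi (0 : ℝ), f (x + t • w) ≤ 3 * ∫⁻ z, f z * rieszKernel x z :=
    fun f hf => (lintegral_mono_set hBsub).trans (lintegral_rays_le hn hf x)
  set ind : ι → Euc n → ℝ≥0∞ := fun i => (Metric.ball (y i) (2 * r i)).indicator fun _ => 1
    with hind
  have hindm : ∀ i, Measurable (ind i) := fun i =>
    measurable_const.indicator measurableSet_ball
  have hballs : ∀ i, ∫⁻ w in B, a i / ENNReal.ofReal (r i) *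
      (∫⁻ t in Ioi (0 : ℝ), ind i (x + t • w)) ≤ 3 * (K₁ * 2 ^ n) *
        (a i * ENNReal.ofReal (r i ^ ((n : ℝ) - 1)) * rieszKernel x (y i)) := by
    intro i
    rw [lintegral_const_mul _ (hrm _ (hindm i))]
    have e1 : ∫⁻ z, ind i z * rieszKernel x z =
        ∫⁻ z in Metric.ball (y i) (2 * r i), rieszKernel x z := by
      rw [← lintegral_indicator measurableSet_ball]
      refine lintegral_congr fun z => ?_
      by_cases hz : z ∈ Metric.ball (y i) (2 * r i) <;> simp [hind, hz]
    have hri : ENNReal.ofReal (r i) ≠ 0 := by simpa using hr i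
    have e2 : ENNReal.ofReal ((2 * r i) ^ n) =
        2 ^ n * (ENNReal.ofReal (r i) * ENNReal.ofReal (r i ^ ((n : ℝ) - 1))) := by
      rw [mul_pow, ENNReal.ofReal_mul (by positivity), ← ENNReal.ofReal_mul (hr i).le,
        ENNReal.ofReal_pow (by norm_num)]
      congr 1
      · simp
      · rw [Real.rpow_sub_one (hr i).ne', Real.rpow_natCast, mul_div_cancel₀ _ (hr i).ne']
    calc a i / ENNReal.ofReal (r i) * ∫⁻ w in B, ∫⁻ t in Ioi (0 : ℝ), ind i (x + t • w)
        ≤ a i / ENNReal.ofReal (r i) * (3 * (K₁ * (ENNReal.ofReal ((2 * r i) ^ n) *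
            rieszKernel x (y i)))) := by
          gcongr
          refine (hrays _ (hindm i)).trans ?_
          rw [e1]
          gcongr
          exact hK₁ x (y i) (2 * r i) (by have := hr i; positivity)
      _ = (a i / ENNReal.ofReal (r i) * ENNReal.ofReal (r i)) * (3 * (K₁ * 2 ^ n) *
            ENNReal.ofReal (r i ^ ((n : ℝ) - 1)) * rieszKernel x (y i)) := by rw [e2]; ring
      _ = _ := by rw [ENNReal.div_mul_cancel hri ENNReal.ofReal_ne_top]; ring
  have hliminf : ∫⁻ w in B, Filter.liminf (fun j => ∫⁻ t in Ioi (0 : ℝ),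
      mollifiedNorm Ω E (φ j) (x + t • w)) Filter.atTop ≤
        3 * K₂ * ∫⁻ z in Ω, ‖E z‖ₑ * rieszKernel x z := by
    refine (lintegral_liminf_le fun j => hrm _ (hmol j).1).trans ?_
    refine Filter.liminf_le_of_le (by isBoundedDefault) fun b hb => ?_
    obtain ⟨j, hj⟩ := hb.exists
    refine hj.trans ((hrays _ (hmol j).1).trans ?_)
    rw [mul_assoc]
    gcongr
    exact (hmol j).2 x
  have hmain : V * ‖u x‖ₑ ≤ 4 * (V * c + 3 * (K₁ * 2 ^ n) *
      (∑' i, a i * ENNReal.ofReal (r i ^ ((n : ℝ) - 1)) * rieszKernel x (y i)) +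
        3 * K₂ * ∫⁻ z in Ω, ‖E z‖ₑ * rieszKernel x z) := by
    have hsm : Measurable fun w => ∑' i, a i / ENNReal.ofReal (r i) *
        (∫⁻ t in Ioi (0 : ℝ), ind i (x + t • w)) :=
      Measurable.tsum fun i => (hrm _ (hindm i)).const_mul _
    calc V * ‖u x‖ₑ = ∫⁻ w in B, ‖u x‖ₑ := by rw [setLIntegral_const, hVB, mul_comm]
      _ ≤ ∫⁻ w in B, 4 * ((c + ∑' i, a i / ENNReal.ofReal (r i) *
            (∫⁻ t in Ioi (0 : ℝ), ind i (x + t • w))) +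
            Filter.liminf (fun j => ∫⁻ t in Ioi (0 : ℝ), mollifiedNorm Ω E (φ j) (x + t • w))
              Filter.atTop) := by
          refine setLIntegral_mono' measurableSet_ball fun w hw => ?_
          obtain ⟨hw1, hw2, hw3⟩ := inner_lower_bound hv hw
          refine hw3.trans ?_
          gcongr
          exact enorm_inner_le_ray h hΩ hu hφ₂ hr hcov hx hw2
            (norm_pos_iff.1 (by linarith))
      _ = 4 * ((V * c + ∑' i, ∫⁻ w in B, a i / ENNReal.ofReal (r i) *
            (∫⁻ t in Ioi (0 : ℝ), ind i (x + t • w))) +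
            ∫⁻ w in B, Filter.liminf (fun j => ∫⁻ t in Ioi (0 : ℝ),
              mollifiedNorm Ω E (φ j) (x + t • w)) Filter.atTop) := by
          rw [lintegral_const_mul' _ _ (by finiteness), lintegral_add_left (by fun_prop),
            lintegral_add_left measurable_const, setLIntegral_const, hVB, mul_comm c,
            lintegral_tsum fun i => ((hrm _ (hindm i)).const_mul _).aemeasurable]
      _ ≤ _ := by
          gcongr
          rw [← ENNReal.tsum_mul_left]
          exact ENNReal.tsum_le_tsum hballs
  calc ‖u x‖ₑ = V⁻¹ * (V * ‖u x‖ₑ) := by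
        rw [← mul_assoc, ENNReal.inv_mul_cancel hV0 hVt, one_mul]
    _ ≤ V⁻¹ * (4 * (V * c + 3 * (K₁ * 2 ^ n) *
        (∑' i, a i * ENNReal.ofReal (r i ^ ((n : ℝ) - 1)) * rieszKernel x (y i)) +
        3 * K₂ * ∫⁻ z in Ω, ‖E z‖ₑ * rieszKernel x z)) := by gcongr
    _ ≤ V⁻¹ * (4 * ((V + 3 * (K₁ * 2 ^ n) + 3 * K₂) * c + (V + 3 * (K₁ * 2 ^ n) + 3 * K₂) *
        (∑' i, a i * ENNReal.ofReal (r i ^ ((n : ℝ) - 1)) * rieszKernel x (y i)) +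
        (V + 3 * (K₁ * 2 ^ n) + 3 * K₂) * ∫⁻ z in Ω, ‖E z‖ₑ * rieszKernel x z)) := by
        gcongr
        · exact le_self_add.trans le_self_add
        · exact le_add_self.trans le_self_add
        · exact le_add_self
    _ = _ := by rw [hD]; ring

/-- Covering by balls with controlled content of a set of small Hausdorff measure. -/
theorem exists_balls_of_hausdorffMeasure_lt {n : ℕ} {s : ℝ} (hs : 0 < s) {F : Set (Euc n)}
    {h : ℝ≥0∞} (hF : μH[s] F < h) : ∃ (y : ℕ → Euc n) (r : ℕ → ℝ), (∀ i, 0 < r i) ∧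
      F ⊆ ⋃ i, Metric.ball (y i) (r i) ∧
      ∑' i, ENNReal.ofReal (r i ^ s) ≤ 2 ^ s * (2 * h) := by
  have hh : h ≠ 0 := (bot_le.trans_lt hF).ne'
  rw [Measure.hausdorffMeasure_apply] at hF
  have hF1 := (le_iSup₂ (f := fun (r : ℝ≥0∞) (_ : 0 < r) =>
    ⨅ (t : ℕ → Set (Euc n)) (_ : F ⊆ ⋃ n, t n) (_ : ∀ n, Metric.ediam (t n) ≤ r),
      ∑' n, ⨆ _ : (t n).Nonempty, Metric.ediam (t n) ^ s) 1 one_pos).trans_lt hF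
  simp only [iInf_lt_iff] at hF1
  obtain ⟨t, ht, hd, hsum⟩ := hF1
  obtain ⟨e, he, hesum⟩ := ENNReal.exists_pos_sum_of_countable hh ℕ
  set d : ℕ → ℝ≥0∞ := fun i => Metric.ediam (t i) with hdd
  have hdt : ∀ i, d i ≠ ⊤ := fun i => ((hd i).trans_lt ENNReal.one_lt_top).ne
  set ρ : ℕ → ℝ≥0∞ := fun i => d i + (e i : ℝ≥0∞) ^ (1 / s) with hρ
  have het : ∀ i, (e i : ℝ≥0∞) ^ (1 / s) ≠ ⊤ := fun i =>
    ENNReal.rpow_ne_top_of_nonneg (by positivity) ENNReal.coe_ne_top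
  have hep : ∀ i, 0 < (e i : ℝ≥0∞) ^ (1 / s) := fun i =>
    ENNReal.rpow_pos (by exact_mod_cast he i) ENNReal.coe_ne_top
  have hρt : ∀ i, ρ i ≠ ⊤ := fun i => ENNReal.add_ne_top.2 ⟨hdt i, het i⟩
  have hρs : ∀ i, ENNReal.ofReal ((ρ i).toReal ^ s) = ρ i ^ s := fun i => by
    rw [ENNReal.toReal_rpow, ENNReal.ofReal_toReal (ENNReal.rpow_ne_top_of_nonneg hs.le (hρt i))]
  have hee : ∀ i, ((e i : ℝ≥0∞) ^ (1 / s)) ^ s = e i := fun i => by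
    rw [← ENNReal.rpow_mul, one_div_mul_cancel hs.ne', ENNReal.rpow_one]
  have hpow : ∀ a b : ℝ≥0∞, (a + b) ^ s ≤ 2 ^ s * (a ^ s + b ^ s) := fun a b => by
    calc (a + b) ^ s ≤ (2 * max a b) ^ s := by
          gcongr
          rw [two_mul]
          exact add_le_add (le_max_left _ _) (le_max_right _ _)
      _ = 2 ^ s * max a b ^ s := ENNReal.mul_rpow_of_nonneg _ _ hs.le
      _ ≤ _ := by
          gcongr
          rcases le_total a b with hab | hab
          · rw [max_eq_right hab]; exact le_add_self
          · rw [max_eq_left hab]; exact le_self_add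
  classical
  set N : ℕ → Prop := fun i => (t i).Nonempty with hN
  set y : ℕ → Euc n := fun i => if hi : N i then hi.some else 0 with hy
  set R : ℕ → ℝ≥0∞ := fun i => if N i then ρ i else (e i : ℝ≥0∞) ^ (1 / s) with hR
  have hRt : ∀ i, R i ≠ ⊤ := fun i => by
    by_cases hi : N i <;> simp only [hR, hi, if_true, if_false] <;> [exact hρt i; exact het i]
  have hR0 : ∀ i, R i ≠ 0 := fun i => by
    by_cases hi : N i <;> simp only [hR, hi, if_true, if_false]
    · exact ((hep i).trans_le le_add_self).ne'
    · exact (hep i).ne'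
  refine ⟨y, fun i => (R i).toReal, fun i => ENNReal.toReal_pos (hR0 i) (hRt i), ?_, ?_⟩
  · intro z hz
    obtain ⟨i, hi⟩ := mem_iUnion.1 (ht hz)
    have hNi : N i := ⟨z, hi⟩
    refine mem_iUnion.2 ⟨i, ?_⟩
    rw [← Metric.eball_ofReal, ENNReal.ofReal_toReal (hRt i)]
    simp only [hR, hy, hNi, if_true, dif_pos]
    refine (Metric.edist_le_ediam_of_mem hi hNi.some_mem).trans_lt ?_
    exact ENNReal.lt_add_right (hdt i) (hep i).ne'
  · have hRs : ∀ i, ENNReal.ofReal ((R i).toReal ^ s) ≤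
        2 ^ s * ((⨆ _ : (t i).Nonempty, d i ^ s) + e i) := fun i => by
      rw [ENNReal.toReal_rpow, ENNReal.ofReal_toReal (ENNReal.rpow_ne_top_of_nonneg hs.le (hRt i))]
      by_cases hi : N i
      · rw [ciSup_pos hi]
        simp only [hR, hi, if_true]
        refine (hpow _ _).trans ?_
        rw [hee]
      · simp only [hR, hi, if_false]
        rw [hee]
        calc (e i : ℝ≥0∞) = 1 * e i := (one_mul _).symm
          _ ≤ _ := by
            gcongr
            · exact ENNReal.one_le_rpow (by norm_num) hs
            · exact le_add_self
    refine (ENNReal.tsum_le_tsum hRs).trans ?_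
    rw [ENNReal.tsum_mul_left, ENNReal.tsum_add, two_mul]
    gcongr

section Rearrangement

variable {X V : Type*} [MeasurableSpace X] [NormedAddCommGroup V] {ν : Measure X} {f : X → V}

theorem rearr_norm_eq (ν : Measure X) (f : X → V) (s : ℝ) :
    rearr ν (fun x => ‖f x‖) s = sInf {t : ℝ≥0∞ | ν {x | t < ‖f x‖ₑ} ≤ ENNReal.ofReal s} := by
  simp [rearr]

theorem rearr_antitone (ν : Measure X) (f : X → ℝ) : Antitone (rearr ν f) := fun _ _ h =>
  sInf_le_sInf fun _ ht => le_trans ht (ENNReal.ofReal_le_ofReal h)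

theorem lt_measure_of_lt_rearr {s : ℝ} {t : ℝ≥0∞} (h : t < rearr ν (fun x => ‖f x‖) s) :
    ENNReal.ofReal s < ν {x | t < ‖f x‖ₑ} := by
  rw [rearr_norm_eq] at h
  exact not_le.1 fun h' => (h.trans_le (sInf_le h')).false

theorem measure_rearr_lt_le (ν : Measure X) (f : X → V) (s : ℝ) :
    ν {x | rearr ν (fun x => ‖f x‖) s < ‖f x‖ₑ} ≤ ENNReal.ofReal s := by
  rw [rearr_norm_eq]
  set S := {t : ℝ≥0∞ | ν {x | t < ‖f x‖ₑ} ≤ ENNReal.ofReal s} with hS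
  obtain ⟨t, hta, htt, htS⟩ := exists_seq_tendsto_sInf (S := S)
    ⟨⊤, by simp [hS]⟩ (OrderBot.bddBelow S)
  have hU : {x | sInf S < ‖f x‖ₑ} ⊆ ⋃ k, {x | t k < ‖f x‖ₑ} := fun x hx =>
    mem_iUnion.2 (htt.eventually_lt_const hx).exists
  have hmono : Monotone fun k => {x | t k < ‖f x‖ₑ} := fun i j hij x hx =>
    (hta hij).trans_lt hx
  refine (measure_mono hU).trans ?_
  rw [hmono.measure_iUnion]
  exact iSup_le htS

end Rearrangement

/-- Layer-cake decomposition of a function along dyadic values of its rearrangement. -/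
theorem ae_enorm_le_tsum_rearr {X V : Type*} [MeasurableSpace X] [NormedAddCommGroup V]
    (ν : Measure X) (f : X → V) {τ : ℝ} (hτ : 0 < τ)
    (h0 : ∀ ε : ℝ≥0∞, ε ≠ 0 → ∃ k : ℤ, rearr ν (fun x => ‖f x‖) (2 ^ k * τ) < ε) :
    ∀ᵐ x ∂ν, ‖f x‖ₑ ≤ ∑' k : ℤ,
      {x | rearr ν (fun x => ‖f x‖) (2 ^ (k + 1) * τ) < ‖f x‖ₑ}.indicator
        (fun _ => rearr ν (fun x => ‖f x‖) (2 ^ k * τ)) x := by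
  set F : ℤ → ℝ≥0∞ := fun k => rearr ν (fun x => ‖f x‖) (2 ^ k * τ) with hF
  have hanti : Antitone F := fun i j hij => rearr_antitone _ _
    (mul_le_mul_of_nonneg_right (zpow_le_zpow_right₀ one_le_two hij) hτ.le)
  have hnull : ν {x | (⨆ k, F k) < ‖f x‖ₑ} = 0 := by
    have hle : ∀ j : ℕ, ν {x | (⨆ k, F k) < ‖f x‖ₑ} ≤ ENNReal.ofReal ((1 / 2) ^ j * τ) := by
      intro j
      refine (measure_mono fun x hx => ?_).trans (measure_rearr_lt_le ν f _)
      refine lt_of_le_of_lt ?_ (show (⨆ k, F k) < ‖f x‖ₑ from hx)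
      refine le_trans (le_of_eq ?_) (le_iSup F (-(j : ℤ)))
      simp [hF]
    have hlim : Filter.Tendsto (fun j : ℕ => ENNReal.ofReal ((1 / 2) ^ j * τ)) Filter.atTop
        (nhds 0) := by
      rw [← ENNReal.ofReal_zero]
      refine (ENNReal.continuous_ofReal.tendsto 0).comp ?_
      simpa using (tendsto_pow_atTop_nhds_zero_of_lt_one (r := (1 / 2 : ℝ)) (by norm_num)
        (by norm_num)).mul_const τ
    exact le_antisymm (ge_of_tendsto' hlim hle) bot_le
  have hae : ∀ᵐ x ∂ν, ‖f x‖ₑ ≤ ⨆ k, F k := by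
    rw [ae_iff]; simpa using hnull
  filter_upwards [hae] with x hx
  by_cases hx0 : ‖f x‖ₑ = 0
  · rw [hx0]; exact bot_le
  by_cases hall : ∀ k, F k < ‖f x‖ₑ
  · refine hx.trans (iSup_le fun k => ?_)
    refine le_trans (le_of_eq ?_) (ENNReal.le_tsum k)
    rw [indicator_of_mem]
    exact hall (k + 1)
  · push Not at hall
    obtain ⟨k₀, hk₀⟩ := hall
    obtain ⟨k₁, hk₁⟩ := h0 _ hx0
    obtain ⟨k, hk, hkmax⟩ := Int.exists_greatest_of_bdd (P := fun k => ‖f x‖ₑ ≤ F k)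
      ⟨k₁, fun z hz => by
        by_contra hlt
        exact absurd (hz.trans (hanti (not_le.1 hlt).le)) (not_le.2 hk₁)⟩ ⟨k₀, hk₀⟩
    have hk1 : F (k + 1) < ‖f x‖ₑ := by
      by_contra hlt
      have := hkmax _ (not_lt.1 hlt)
      omega
    refine hk.trans (le_trans (le_of_eq ?_) (ENNReal.le_tsum k))
    rw [indicator_of_mem]
    exact hk1

/-- Covering of the superlevel sets of the boundary values by balls of controlled content. -/
theorem exists_frontier_cover {n : ℕ} {s : ℝ} (hs : 0 < s) {Γ : Set (Euc n)} (hΓ : IsClosed Γ)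
    {u : Euc n → Euc n} {A : ℝ≥0} (hA : ∀ z ∈ Γ, ‖u z‖ₑ ≤ A) {σ : ℝ} (hσ : 0 < σ)
    {η : ℝ≥0∞} (hη : 0 < η) {g : ℝ → ℝ≥0∞}
    (hg : g = rearr (μH[s].restrict Γ) (fun x => ‖u x‖)) :
    ∃ (a : ℕ × ℕ → ℝ≥0∞) (y : ℕ × ℕ → Euc n) (r : ℕ × ℕ → ℝ), (∀ i, 0 < r i) ∧
      (∀ z ∈ Γ, ‖u z‖ₑ ≤ g σ ∨ ∃ i, z ∈ Metric.ball (y i) (r i) ∧ ‖u z‖ₑ ≤ a i) ∧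
      ∑' i, a i * ENNReal.ofReal (r i ^ s) ≤ 2 ^ s * 2 * (A * η + 4 * (ENNReal.ofReal σ *
        ∑' k : ℕ, ENNReal.ofReal ((1 / 2) ^ k) * g ((1 / 2) ^ k * σ))) := by
  set F : ℕ → Set (Euc n) := fun k => {z | g ((1 / 2) ^ k * σ) < ‖u z‖ₑ} ∩ Γ with hF
  have hFm : ∀ k, μH[s] (F k) ≤ ENNReal.ofReal ((1 / 2) ^ k * σ) := fun k => by
    have := measure_rearr_lt_le (μH[s].restrict Γ) u ((1 / 2) ^ k * σ)
    rwa [Measure.restrict_apply' hΓ.measurableSet, ← hg] at this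
  set L : ℕ → Set (Euc n) := fun k => Nat.casesOn k (⋂ k, F k) F with hL
  set H : ℕ → ℝ≥0∞ := fun k => Nat.casesOn k η
    fun k => 2 * ENNReal.ofReal ((1 / 2) ^ k * σ) with hH
  set b : ℕ → ℝ≥0∞ := fun k => Nat.casesOn k (A : ℝ≥0∞)
    fun k => g ((1 / 2) ^ (k + 1) * σ) with hb
  have hpos : ∀ k : ℕ, 0 < ENNReal.ofReal ((1 / 2) ^ k * σ) := fun k =>
    ENNReal.ofReal_pos.2 (by positivity)
  have hlt : ∀ k, μH[s] (L k) < H k := by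
    rintro (_ | k)
    · have hlim : Filter.Tendsto (fun j : ℕ => ENNReal.ofReal ((1 / 2) ^ j * σ)) Filter.atTop
          (nhds 0) := by
        rw [← ENNReal.ofReal_zero]
        refine (ENNReal.continuous_ofReal.tendsto 0).comp ?_
        simpa using (tendsto_pow_atTop_nhds_zero_of_lt_one (r := (1 / 2 : ℝ)) (by norm_num)
          (by norm_num)).mul_const σ
      have h0 : μH[s] (⋂ k, F k) ≤ 0 := ge_of_tendsto' hlim fun k =>
        (measure_mono (iInter_subset F k)).trans (hFm k)
      exact h0.trans_lt hη
    · refine (hFm k).trans_lt ?_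
      show _ < 2 * ENNReal.ofReal ((1 / 2) ^ k * σ)
      rw [two_mul]
      exact ENNReal.lt_add_right ENNReal.ofReal_ne_top (hpos k).ne'
  choose y r hr hcov hsum using fun k => exists_balls_of_hausdorffMeasure_lt hs (hlt k)
  refine ⟨fun i => b i.1, fun i => y i.1 i.2, fun i => r i.1 i.2, fun i => hr _ _, ?_, ?_⟩
  · intro z hz
    by_cases h0 : ‖u z‖ₑ ≤ g σ
    · exact Or.inl h0
    right
    by_cases hex : ∃ k : ℕ, ‖u z‖ₑ ≤ g ((1 / 2) ^ k * σ)
    · classical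
      have h1 := Nat.find_spec hex
      rcases hk : Nat.find hex with _ | k
      · rw [hk] at h1; simp only [pow_zero, one_mul] at h1; exact absurd h1 h0
      · have h2 : ¬ ‖u z‖ₑ ≤ g ((1 / 2) ^ k * σ) := Nat.find_min hex (by omega)
        have hzL : z ∈ L (k + 1) := ⟨not_le.1 h2, hz⟩
        obtain ⟨i, hi⟩ := mem_iUnion.1 (hcov (k + 1) hzL)
        rw [hk] at h1
        exact ⟨(k + 1, i), hi, h1⟩
    · push Not at hex
      have hzL : z ∈ L 0 := mem_iInter.2 fun k => ⟨hex k, hz⟩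
      obtain ⟨i, hi⟩ := mem_iUnion.1 (hcov 0 hzL)
      exact ⟨(0, i), hi, hA z hz⟩
  · rw [ENNReal.tsum_prod (f := fun k j => b k * ENNReal.ofReal (r k j ^ s))]
    simp_rw [ENNReal.tsum_mul_left]
    calc ∑' k, b k * ∑' j, ENNReal.ofReal (r k j ^ s)
        ≤ ∑' k, 2 ^ s * 2 * (b k * H k) := by
          refine ENNReal.tsum_le_tsum fun k => ?_
          calc b k * _ ≤ b k * (2 ^ s * (2 * H k)) := by gcongr; exact hsum k
            _ = _ := by ring
      _ = 2 ^ s * 2 * (A * η + ∑' k : ℕ, g ((1 / 2) ^ (k + 1) * σ) *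
            (2 * ENNReal.ofReal ((1 / 2) ^ k * σ))) := by
          rw [ENNReal.tsum_mul_left, tsum_eq_zero_add' ENNReal.summable]
          rfl
      _ ≤ _ := by
          gcongr
          rw [tsum_eq_zero_add' (f := fun k : ℕ => ENNReal.ofReal ((1 / 2) ^ k) *
            g ((1 / 2) ^ k * σ)) ENNReal.summable, mul_add, mul_add]
          refine le_trans (le_of_eq ?_) le_add_self
          rw [← ENNReal.tsum_mul_left, ← ENNReal.tsum_mul_left]
          refine tsum_congr fun k => ?_
          have e1 : ENNReal.ofReal ((1 / 2 : ℝ) ^ k * σ) =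
              2 * (ENNReal.ofReal ((1 / 2 : ℝ) ^ (k + 1)) * ENNReal.ofReal σ) := by
            rw [← ENNReal.ofReal_mul (by positivity),
              show (2 : ℝ≥0∞) = ENNReal.ofReal 2 by simp, ← ENNReal.ofReal_mul (by norm_num)]
            congr 1; ring
          rw [e1]; ring

theorem AhlforsUpper.measure_ball_le {n : ℕ} {Ω : Set (Euc n)} {μ : Measure (Euc n)} {α C : ℝ}
    (h : AhlforsUpper n Ω μ α C) (h0 : μ Ωᶜ = 0) (z : Euc n) {r : ℝ} (hr : 0 < r) :
    μ (Metric.ball z r) ≤ ENNReal.ofReal (C * 2 ^ α * r ^ α) := by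
  have hle : ∀ S, μ S ≤ μ (S ∩ Ω) := fun S => by
    calc μ S ≤ μ (S ∩ Ω ∪ Ωᶜ) := measure_mono fun x hx => by
          by_cases hxΩ : x ∈ Ω
          exacts [Or.inl ⟨hx, hxΩ⟩, Or.inr hxΩ]
      _ ≤ _ := (measure_union_le _ _).trans (by rw [h0, add_zero])
  refine (hle _).trans ?_
  rcases (Metric.ball z r ∩ Ω).eq_empty_or_nonempty with he | ⟨x, hx, hxΩ⟩
  · simp [he]
  · have hsub : Metric.ball z r ⊆ Metric.ball x (2 * r) := by
      refine Metric.ball_subset_ball' ?_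
      rw [Metric.mem_ball, dist_comm] at hx
      linarith
    refine (measure_mono (inter_subset_inter_left _ hsub)).trans
      ((h x hxΩ (2 * r) (by positivity)).trans (le_of_eq ?_))
    rw [Real.mul_rpow (by norm_num) hr.le, mul_assoc]

theorem setLIntegral_enorm_mul_le_tsum {n : ℕ} {V : Type*} [NormedAddCommGroup V]
    {Ω : Set (Euc n)} (hΩ : IsOpen Ω) {E : Euc n → V}
    (hE : AEStronglyMeasurable E (volume.restrict Ω)) {τ : ℝ} (hτ : 0 < τ)
    (h0 : ∀ ε : ℝ≥0∞, ε ≠ 0 →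
      ∃ k : ℤ, rearr (volume.restrict Ω) (fun x => ‖E x‖) (2 ^ k * τ) < ε)
    {W : Euc n → ℝ≥0∞} (hW : Measurable W) {b : ℤ → ℝ≥0∞}
    (hb : ∀ k, ∀ A : Set (Euc n), volume A ≤ ENNReal.ofReal (2 ^ (k + 1) * τ) →
      ∫⁻ z in A, W z ≤ b k) :
    ∫⁻ z in Ω, ‖E z‖ₑ * W z ≤
      ∑' k : ℤ, rearr (volume.restrict Ω) (fun x => ‖E x‖) (2 ^ k * τ) * b k := by
  set ν := volume.restrict Ω with hν
  set F : ℝ → ℝ≥0∞ := rearr ν (fun x => ‖E x‖) with hF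
  set A : ℤ → Set (Euc n) := fun k => {x | F (2 ^ (k + 1) * τ) < ‖E x‖ₑ} with hA
  have hAm : ∀ k, NullMeasurableSet (A k) ν := fun k =>
    nullMeasurableSet_lt aemeasurable_const hE.enorm
  have hAi : ∀ k, ∫⁻ z in A k, W z ∂ν ≤ b k := fun k => by
    rw [hν, Measure.restrict_restrict₀ (hAm k)]
    refine hb k _ ?_
    rw [← Measure.restrict_apply' hΩ.measurableSet]
    exact measure_rearr_lt_le ν E _
  calc ∫⁻ z, ‖E z‖ₑ * W z ∂ν
      ≤ ∫⁻ z, ∑' k : ℤ, F (2 ^ k * τ) * (A k).indicator W z ∂ν := by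
        refine lintegral_mono_ae ?_
        filter_upwards [ae_enorm_le_tsum_rearr ν E hτ h0] with z hz
        refine (mul_le_mul_left hz _).trans (le_of_eq ?_)
        rw [← ENNReal.tsum_mul_right]
        refine tsum_congr fun k => ?_
        by_cases hzA : z ∈ A k
        · rw [indicator_of_mem (by exact hzA), indicator_of_mem hzA]
        · rw [indicator_of_notMem (by exact hzA), indicator_of_notMem hzA, zero_mul, mul_zero]
    _ = ∑' k : ℤ, F (2 ^ k * τ) * ∫⁻ z in A k, W z ∂ν := by
        rw [lintegral_tsum fun k => (hW.aemeasurable.indicator₀ (hAm k)).const_mul _]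
        refine tsum_congr fun k => ?_
        rw [lintegral_const_mul'' _ (hW.aemeasurable.indicator₀ (hAm k)),
          lintegral_indicator₀ (hAm k)]
    _ ≤ _ := ENNReal.tsum_le_tsum fun k => by gcongr; exact hAi k

theorem rpow_one_sub_mul_le {N : ℝ≥0∞} {m e : ℝ} (hN0 : N ≠ 0) (hNt : N ≠ ⊤)
    (hm : 0 ≤ m) (hmN : ENNReal.ofReal m ≤ N) (he : 0 ≤ e) :
    N ^ (1 - e) * ENNReal.ofReal (m ^ e) ≤ N := by
  rw [← ENNReal.ofReal_rpow_of_nonneg hm he]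
  calc N ^ (1 - e) * ENNReal.ofReal m ^ e ≤ N ^ (1 - e) * N ^ e := by gcongr
    _ = N := by rw [← ENNReal.rpow_add _ _ hN0 hNt, sub_add_cancel, ENNReal.rpow_one]

theorem tsum_int_min_eq_top {n : ℕ} {F : ℤ → ℝ≥0∞} {ε : ℝ≥0∞} (hε : ε ≠ 0)
    (hF : ∀ k, ε ≤ F k) :
    ∑' k : ℤ, ENNReal.ofReal (min (((2 : ℝ) ^ k) ^ (1 / (n : ℝ))) (2 ^ k)) * F k = ⊤ := by
  refine top_le_iff.1 ?_
  calc (⊤ : ℝ≥0∞) = ∑' _ : ℕ, ε := (ENNReal.tsum_const_eq_top_of_ne_zero hε).symm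
    _ ≤ ∑' k : ℕ, ENNReal.ofReal (min (((2 : ℝ) ^ (k : ℤ)) ^ (1 / (n : ℝ))) (2 ^ (k : ℤ))) *
        F k := by
        refine ENNReal.tsum_le_tsum fun k => ?_
        have h1 : (1 : ℝ) ≤ 2 ^ (k : ℤ) := one_le_zpow₀ one_le_two (by positivity)
        calc ε = ENNReal.ofReal 1 * ε := by simp
          _ ≤ _ := by
            gcongr
            · exact le_min (Real.one_le_rpow h1 (by positivity)) h1
            · exact hF k
    _ ≤ _ := ENNReal.tsum_comp_le_tsum_of_injective Nat.cast_injective _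

/-- Pointwise inequality between the rearrangements of `u`, of its boundary values and of its
symmetric gradient. -/
theorem exists_rearr_le (n : ℕ) (hn : 2 ≤ n) (α Cμ : ℝ) (hα : (n : ℝ) - 1 < α) (hCμ : 0 < Cμ) :
    ∃ C : ℝ≥0, ∀ (Ω : Set (Euc n)), IsOpen Ω → ∀ μ : Measure (Euc n), μ Ωᶜ = 0 →
      AhlforsUpper n Ω μ α Cμ →
    ∀ (u : Euc n → Euc n) (E : Euc n → EuclideanSpace ℝ (Fin n × Fin n)),
      IsSymmGradOn n Ω u E → MemCb n Ω u → ∀ m : ℝ, 0 < m →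
      rearr μ (fun x => ‖u x‖) m ≤ C * (
        ∑' k : ℕ, ENNReal.ofReal ((1 / 2) ^ k) *
          rearr (μH[(n : ℝ) - 1].restrict (frontier Ω)) (fun x => ‖u x‖)
            ((1 / 2) ^ k * m ^ (((n : ℝ) - 1) / α)) +
        ENNReal.ofReal (m ^ (1 / α)) * ∑' k : ℤ,
          ENNReal.ofReal (min (((2 : ℝ) ^ k) ^ (1 / (n : ℝ))) (2 ^ k)) *
            rearr (volume.restrict Ω) (fun x => ‖E x‖) (2 ^ k * m ^ ((n : ℝ) / α))) := by
  have hn' : (2 : ℝ) ≤ n := by exact_mod_cast hn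
  have hα0 : 0 < α := by linarith
  set s : ℝ := (n : ℝ) - 1 with hs
  have hs0 : 0 < s := by rw [hs]; linarith
  obtain ⟨C₀, hC₀⟩ := exists_enorm_le_potential n hn
  obtain ⟨K, hK⟩ := exists_lintegral_rieszKernel_le n hn α (Cμ * 2 ^ α) hα (by positivity)
  obtain ⟨K', hK'⟩ := exists_setLIntegral_rieszKernel_le n hn
  set D : ℝ≥0∞ := (C₀ + 1) * (1 + 2 ^ s * 8 * K + 2 * (K + K')) with hD
  have h2s : (2 : ℝ≥0∞) ^ s ≠ ⊤ := ENNReal.rpow_ne_top_of_nonneg hs0.le (by simp)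
  have hDt : D ≠ ⊤ := by rw [hD]; finiteness
  refine ⟨D.toNNReal, ?_⟩
  rw [ENNReal.coe_toNNReal hDt]
  intro Ω hΩ μ hμ hAhl u E h hu m hm
  set g : ℝ → ℝ≥0∞ := rearr (μH[s].restrict (frontier Ω)) (fun x => ‖u x‖) with hg
  set F : ℝ → ℝ≥0∞ := rearr (volume.restrict Ω) (fun x => ‖E x‖) with hF
  set σ : ℝ := m ^ (s / α) with hσ
  set τ : ℝ := m ^ ((n : ℝ) / α) with hτ
  have hσ0 : 0 < σ := Real.rpow_pos_of_pos hm _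
  have hτ0 : 0 < τ := Real.rpow_pos_of_pos hm _
  set Sg : ℝ≥0∞ := ∑' k : ℕ, ENNReal.ofReal ((1 / 2) ^ k) * g ((1 / 2) ^ k * σ) with hSg
  set SE : ℝ≥0∞ := ∑' k : ℤ, ENNReal.ofReal (min (((2 : ℝ) ^ k) ^ (1 / (n : ℝ))) (2 ^ k)) *
    F (2 ^ k * τ) with hSE
  obtain ⟨A, hA⟩ := hu.exists_bound
  have hE : AEStronglyMeasurable E (volume.restrict Ω) := h.2.1.aestronglyMeasurable
  by_cases h0 : ∀ ε : ℝ≥0∞, ε ≠ 0 → ∃ k : ℤ, F (2 ^ k * τ) < ε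
  swap
  · push Not at h0
    obtain ⟨ε, hε, hεF⟩ := h0
    have hSEt : SE = ⊤ := tsum_int_min_eq_top (F := fun k : ℤ => F (2 ^ k * τ)) hε hεF
    have hD0 : D ≠ 0 := by
      rw [hD]
      exact mul_ne_zero (by simp) (by simp)
    have hm0 : ENNReal.ofReal (m ^ (1 / α)) ≠ 0 := by
      simpa using Real.rpow_pos_of_pos hm _
    rw [hSEt, ENNReal.mul_top hm0, add_top, ENNReal.mul_top hD0]
    exact le_top
  refine le_of_forall_lt_imp_le_of_dense fun t ht => ?_
  set G : Set (Euc n) := {x | t < ‖u x‖ₑ} ∩ Ω with hG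
  have hGo : IsOpen G := by
    rw [hG, inter_comm]
    exact (hu.1.mono subset_closure).enorm.isOpen_inter_preimage hΩ isOpen_Ioi
  set N : ℝ≥0∞ := μ G with hN
  have hmN : ENNReal.ofReal m ≤ N := by
    refine (lt_measure_of_lt_rearr ht).le.trans ?_
    calc μ {x | t < ‖u x‖ₑ} ≤ μ (G ∪ Ωᶜ) := measure_mono fun x hx => by
          by_cases hxΩ : x ∈ Ω
          exacts [Or.inl ⟨hx, hxΩ⟩, Or.inr hxΩ]
      _ ≤ _ := (measure_union_le _ _).trans (by rw [hμ, add_zero])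
  have hN0 : N ≠ 0 := ((ENNReal.ofReal_pos.2 hm).trans_le hmN).ne'
  have hNt : N ≠ ⊤ := by
    obtain ⟨R, hR⟩ := hu.exists_eq_zero
    have hsub : G ⊆ Metric.ball 0 (|R| + 1) := by
      intro x hx
      rw [mem_ball_zero_iff]
      by_contra hlt
      have h1 : u x = 0 := hR x (subset_closure hx.2) (by
        have := le_abs_self R
        linarith [not_lt.1 hlt])
      have h2 : t < ‖u x‖ₑ := hx.1
      rw [h1, enorm_zero] at h2
      exact not_lt_bot h2
    exact ((measure_mono hsub).trans_lt ((hAhl.measure_ball_le hμ 0 (by positivity)).trans_lt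
      ENNReal.ofReal_lt_top)).ne
  set ν := μ.restrict G with hν
  have hνN : ν univ = N := by rw [hν, Measure.restrict_apply_univ]
  have hfin : IsFiniteMeasure ν := ⟨by rw [hνN]; exact hNt.lt_top⟩
  have hKν : ∀ z, ∫⁻ x, rieszKernel x z ∂ν ≤ K * N ^ (1 - s / α) := by
    have := hK ν (by rw [hνN]; exact hNt) fun z r hr =>
      (Measure.restrict_apply_le _ _).trans (hAhl.measure_ball_le hμ z hr)
    rwa [hνN] at this
  have hNσ : N ^ (1 - s / α) * ENNReal.ofReal σ ≤ N :=
    rpow_one_sub_mul_le hN0 hNt hm.le hmN (by positivity)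
  set W : Euc n → ℝ≥0∞ := fun z => ∫⁻ x, rieszKernel x z ∂ν with hW
  have hkm : Measurable fun p : Euc n × Euc n => rieszKernel p.1 p.2 := measurable_rieszKernel
  have hWm : Measurable W := hkm.lintegral_prod_left'
  set M : ℝ≥0∞ := ENNReal.ofReal (m ^ (1 / α)) with hM
  have hmτ : τ = σ * m ^ (1 / α) := by
    rw [hτ, hσ, ← Real.rpow_add hm, hs]; congr 1; field_simp; ring
  have hτn : ENNReal.ofReal τ ^ (1 / (n : ℝ)) = M := by
    rw [ENNReal.ofReal_rpow_of_nonneg hτ0.le (by positivity), hM, hτ, ← Real.rpow_mul hm.le]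
    congr 2; field_simp
  have hWb : ∀ k : ℤ, ∀ B : Set (Euc n), volume B ≤ ENNReal.ofReal (2 ^ (k + 1) * τ) →
      ∫⁻ z in B, W z ≤ 2 * (K + K') * N * M *
        ENNReal.ofReal (min (((2 : ℝ) ^ k) ^ (1 / (n : ℝ))) (2 ^ k)) := by
    intro k B hB
    have h2k : (0 : ℝ) < 2 ^ k := by positivity
    have hB' : volume B ≤ 2 * ENNReal.ofReal (2 ^ k) * ENNReal.ofReal τ := by
      refine hB.trans (le_of_eq ?_)
      rw [zpow_add_one₀ two_ne_zero, ENNReal.ofReal_mul (by positivity),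
        ENNReal.ofReal_mul (by positivity), mul_comm (ENNReal.ofReal (2 ^ k))]
      simp
    have b1 : ∫⁻ z in B, W z ≤ 2 * K * N * M * ENNReal.ofReal (2 ^ k) := by
      calc ∫⁻ z in B, W z ≤ ∫⁻ z in B, K * N ^ (1 - s / α) := lintegral_mono fun z => hKν z
        _ = K * N ^ (1 - s / α) * volume B := by rw [setLIntegral_const]
        _ ≤ K * N ^ (1 - s / α) * (2 * ENNReal.ofReal (2 ^ k) * ENNReal.ofReal τ) := by gcongr
        _ = K * (N ^ (1 - s / α) * ENNReal.ofReal σ) * (2 * ENNReal.ofReal (2 ^ k) * M) := by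
            rw [hmτ, ENNReal.ofReal_mul hσ0.le]; ring
        _ ≤ K * N * (2 * ENNReal.ofReal (2 ^ k) * M) := by gcongr
        _ = _ := by ring
    have b2 : ∫⁻ z in B, W z ≤
        2 * K' * N * M * ENNReal.ofReal (((2 : ℝ) ^ k) ^ (1 / (n : ℝ))) := by
      have hBt : volume B ≠ ⊤ := (hB.trans_lt ENNReal.ofReal_lt_top).ne
      calc ∫⁻ z in B, W z = ∫⁻ x, (∫⁻ z in B, rieszKernel x z) ∂ν :=
            (lintegral_lintegral_swap hkm.aemeasurable).symm
        _ ≤ ∫⁻ _, K' * volume B ^ (1 / (n : ℝ)) ∂ν := lintegral_mono fun x => hK' B hBt x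
        _ = K' * volume B ^ (1 / (n : ℝ)) * N := by rw [lintegral_const, hνN]
        _ ≤ K' * (2 * ENNReal.ofReal (2 ^ k) * ENNReal.ofReal τ) ^ (1 / (n : ℝ)) * N := by
            gcongr
        _ = K' * (2 ^ (1 / (n : ℝ)) * ENNReal.ofReal (((2 : ℝ) ^ k) ^ (1 / (n : ℝ))) * M) *
              N := by
            rw [ENNReal.mul_rpow_of_nonneg _ _ (by positivity),
              ENNReal.mul_rpow_of_nonneg _ _ (by positivity), hτn,
              ENNReal.ofReal_rpow_of_nonneg h2k.le (by positivity)]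
        _ ≤ K' * (2 ^ (1 : ℝ) * ENNReal.ofReal (((2 : ℝ) ^ k) ^ (1 / (n : ℝ))) * M) * N := by
            gcongr
            · norm_num
            · rw [div_le_one (by positivity)]; linarith
        _ = _ := by rw [ENNReal.rpow_one]; ring
    rcases min_choice (((2 : ℝ) ^ k) ^ (1 / (n : ℝ))) (2 ^ k) with h1 | h1 <;> rw [h1]
    · refine b2.trans ?_
      gcongr
      exact le_add_self
    · refine b1.trans ?_
      gcongr
      exact le_self_add
  have hEint : ∫⁻ x, (∫⁻ z in Ω, ‖E z‖ₑ * rieszKernel x z) ∂ν ≤ 2 * (K + K') * N * M * SE := by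
    calc ∫⁻ x, (∫⁻ z in Ω, ‖E z‖ₑ * rieszKernel x z) ∂ν
        = ∫⁻ z in Ω, (∫⁻ x, ‖E z‖ₑ * rieszKernel x z ∂ν) := by
          refine lintegral_lintegral_swap ?_
          exact (hE.enorm.comp_snd (μ := ν)).mul hkm.aemeasurable
      _ = ∫⁻ z in Ω, ‖E z‖ₑ * W z := by
          refine lintegral_congr fun z => lintegral_const_mul _ ?_
          exact measurable_rieszKernel_left z
      _ ≤ ∑' k : ℤ, F (2 ^ k * τ) * (2 * (K + K') * N * M *
            ENNReal.ofReal (min (((2 : ℝ) ^ k) ^ (1 / (n : ℝ))) (2 ^ k))) :=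
          setLIntegral_enorm_mul_le_tsum hΩ hE hτ0 h0 hWm hWb
      _ = _ := by
          rw [hSE, ← ENNReal.tsum_mul_left]
          exact tsum_congr fun k => by ring
  set X : ℝ≥0∞ := N * (D * (Sg + M * SE)) with hX
  set Y : ℝ≥0∞ := C₀ * (K * N ^ (1 - s / α) * (2 ^ s * 2 * A)) with hY
  have hYt : Y ≠ ⊤ := by
    have : N ^ (1 - s / α) ≠ ⊤ := ENNReal.rpow_ne_top_of_nonneg
      (sub_nonneg.2 ((div_le_one hα0).2 hα.le)) hNt
    rw [hY]; finiteness
  have hη : ∀ η : ℝ≥0, 0 < η → N * t ≤ X + Y * η := by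
    intro η hη0
    obtain ⟨a, y, r, hr, hcov, hsum⟩ := exists_frontier_cover hs0 (Γ := frontier Ω)
      isClosed_frontier (fun z hz => hA z (frontier_subset_closure hz)) hσ0
      (η := η) (by exact_mod_cast hη0) hg
    have hpt := hC₀ Ω u E h hΩ hu (ℕ × ℕ) (g σ) a y r hr hcov
    have hbd : ∫⁻ x, ∑' i, a i * ENNReal.ofReal (r i ^ s) * rieszKernel x (y i) ∂ν ≤
        K * N ^ (1 - s / α) * (2 ^ s * 2 * A) * η + 2 ^ s * 8 * K * (N * Sg) := by
      have hkl : ∀ i, Measurable fun x => rieszKernel x (y i) := fun i =>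
        measurable_rieszKernel_left (y i)
      rw [lintegral_tsum fun i => ((hkl i).const_mul _).aemeasurable]
      calc ∑' i, ∫⁻ x, a i * ENNReal.ofReal (r i ^ s) * rieszKernel x (y i) ∂ν
          ≤ ∑' i, a i * ENNReal.ofReal (r i ^ s) * (K * N ^ (1 - s / α)) := by
            refine ENNReal.tsum_le_tsum fun i => ?_
            rw [lintegral_const_mul _ (hkl i)]
            gcongr
            exact hKν _
        _ ≤ (2 ^ s * 2 * (A * η + 4 * (ENNReal.ofReal σ * Sg))) * (K * N ^ (1 - s / α)) := by
            rw [ENNReal.tsum_mul_right]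
            gcongr
        _ = K * N ^ (1 - s / α) * (2 ^ s * 2 * A) * η +
              2 ^ s * 8 * K * ((N ^ (1 - s / α) * ENNReal.ofReal σ) * Sg) := by ring
        _ ≤ _ := by gcongr
    have hgσ : g σ ≤ Sg := by
      refine le_trans (le_of_eq ?_) (ENNReal.le_tsum 0)
      simp
    calc N * t = ∫⁻ _, t ∂ν := by rw [lintegral_const, hνN, mul_comm]
      _ ≤ ∫⁻ x, C₀ * (g σ + ∑' i, a i * ENNReal.ofReal (r i ^ s) * rieszKernel x (y i) +
            (∫⁻ z in Ω, ‖E z‖ₑ * rieszKernel x z)) ∂ν := by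
          refine setLIntegral_mono' hGo.measurableSet fun x hx => ?_
          exact (show t < ‖u x‖ₑ from hx.1).le.trans (hpt x hx.2)
      _ = C₀ * (g σ * N + ∫⁻ x, ∑' i, a i * ENNReal.ofReal (r i ^ s) * rieszKernel x (y i) ∂ν +
            ∫⁻ x, (∫⁻ z in Ω, ‖E z‖ₑ * rieszKernel x z) ∂ν) := by
          have hsm : Measurable fun x =>
              ∑' i, a i * ENNReal.ofReal (r i ^ s) * rieszKernel x (y i) :=
            Measurable.tsum fun i => (measurable_rieszKernel_left (y i)).const_mul _
          have hsm' : Measurable fun x => g σ +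
              ∑' i, a i * ENNReal.ofReal (r i ^ s) * rieszKernel x (y i) :=
            measurable_const.add hsm
          rw [lintegral_const_mul' _ _ ENNReal.coe_ne_top, lintegral_add_left hsm', lintegral_add_left measurable_const,
            lintegral_const, hνN]
      _ ≤ C₀ * (Sg * N + (K * N ^ (1 - s / α) * (2 ^ s * 2 * A) * η + 2 ^ s * 8 * K * (N * Sg)) +
            2 * (K + K') * N * M * SE) := by gcongr
      _ = C₀ * (N * ((1 + 2 ^ s * 8 * K) * Sg + 2 * (K + K') * (M * SE))) + Y * η := by
          rw [hY]; ring
      _ ≤ (C₀ + 1) * (N * ((1 + 2 ^ s * 8 * K + 2 * (K + K')) * Sg +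
            (1 + 2 ^ s * 8 * K + 2 * (K + K')) * (M * SE))) + Y * η := by
          have hadd : ∀ P Q a b : ℝ≥0∞, P * a + Q * b ≤ (P + Q) * a + (P + Q) * b :=
            fun P Q a b => add_le_add (mul_le_mul_left le_self_add _)
              (mul_le_mul_left le_add_self _)
          exact add_le_add (mul_le_mul' le_self_add (mul_le_mul_right (hadd _ _ _ _) _)) le_rfl
      _ = X + Y * η := by rw [hX, hD]; ring
  have hNX : N * t ≤ X := by
    refine ENNReal.le_of_forall_pos_le_add fun ε hε _ => ?_
    obtain ⟨η, hη0, hηε⟩ := ENNReal.exists_nnreal_pos_mul_lt hYt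
      (show (ε : ℝ≥0∞) ≠ 0 by exact_mod_cast hε.ne')
    refine (hη η hη0).trans ?_
    gcongr
    rw [mul_comm]
    exact hηε.le
  exact (ENNReal.mul_le_mul_iff_right hN0 hNt).1 hNX

/-- Minkowski inequality for countable sums in `L^p`. -/
theorem lintegral_Lp_tsum_le {X ι : Type*} [MeasurableSpace X] [Countable ι] {μ : Measure X}
    {p : ℝ} (hp : 1 ≤ p) {F : ι → X → ℝ≥0∞} (hF : ∀ i, Measurable (F i)) :
    (∫⁻ x, (∑' i, F i x) ^ p ∂μ) ^ (1 / p) ≤ ∑' i, (∫⁻ x, F i x ^ p ∂μ) ^ (1 / p) := by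
  have hp0 : 0 < p := by linarith
  have hfin : ∀ S : Finset ι, (∫⁻ x, (∑ i ∈ S, F i x) ^ p ∂μ) ^ (1 / p) ≤
      ∑ i ∈ S, (∫⁻ x, F i x ^ p ∂μ) ^ (1 / p) := by
    classical
    intro S
    induction S using Finset.induction with
    | empty => simp [hp0]
    | insert i S hi ih =>
      simp_rw [Finset.sum_insert hi]
      refine le_trans ?_ (add_le_add le_rfl ih)
      exact ENNReal.lintegral_Lp_add_le (hF i).aemeasurable
        (Finset.measurable_fun_sum S fun i _ => hF i).aemeasurable hp
  rw [one_div, ENNReal.rpow_inv_le_iff hp0]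
  have hsup : ∀ x, (∑' i, F i x) ^ p = ⨆ S : Finset ι, (∑ i ∈ S, F i x) ^ p := fun x => by
    rw [ENNReal.tsum_eq_iSup_sum]
    exact (ENNReal.orderIsoRpow p hp0).map_iSup _
  simp_rw [hsup]
  rw [lintegral_iSup_directed (fun S =>
    ((Finset.measurable_fun_sum S fun i _ => hF i).pow_const p).aemeasurable)]
  · refine iSup_le fun S => ?_
    have h1 := hfin S
    rw [one_div, ENNReal.rpow_inv_le_iff hp0] at h1
    refine h1.trans ?_
    gcongr
    exact ENNReal.sum_le_tsum S
  · refine Monotone.directed_le fun S T hST x => ?_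
    exact ENNReal.rpow_le_rpow (Finset.sum_le_sum_of_subset hST) hp0.le

/-- The Lorentz functional `‖s^{1/p-1/q} h(s)‖_{L^q(0,∞)}`. -/
def lorentzFun (p : ℝ) (q : ℝ≥0∞) (h : ℝ → ℝ≥0∞) : ℝ≥0∞ :=
  if q = ⊤ then ⨆ s ∈ Set.Ioi (0 : ℝ), ENNReal.ofReal (s ^ (1 / p)) * h s
  else (∫⁻ s in Set.Ioi (0 : ℝ),
      (ENNReal.ofReal (s ^ (1 / p - 1 / q.toReal)) * h s) ^ q.toReal) ^ (1 / q.toReal)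

theorem lorentzNorm_eq {X : Type*} [MeasurableSpace X] (ν : Measure X) (p : ℝ) (q : ℝ≥0∞)
    (f : X → ℝ) : lorentzNorm ν p q f = lorentzFun p q (rearr ν f) := rfl

theorem one_le_toReal_of_ne_top {q : ℝ≥0∞} (hq : 1 ≤ q) (hqt : q ≠ ⊤) : 1 ≤ q.toReal := by
  rw [← ENNReal.toReal_one]
  exact ENNReal.toReal_mono hqt hq

theorem lorentzFun_mono (p : ℝ) (q : ℝ≥0∞) {h h' : ℝ → ℝ≥0∞} (hh : ∀ s, 0 < s → h s ≤ h' s) :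
    lorentzFun p q h ≤ lorentzFun p q h' := by
  unfold lorentzFun
  split_ifs
  · exact iSup₂_mono fun s hs => mul_le_mul_right (hh s hs) _
  · gcongr ?_ ^ _
    refine setLIntegral_mono' measurableSet_Ioi fun s hs => ?_
    gcongr
    exact hh s hs

theorem lorentzFun_const_mul_le (p : ℝ) {q : ℝ≥0∞} (hq : 1 ≤ q) {c : ℝ≥0∞} (hc : c ≠ ⊤)
    (h : ℝ → ℝ≥0∞) : lorentzFun p q (fun s => c * h s) ≤ c * lorentzFun p q h := by
  unfold lorentzFun
  split_ifs with hqt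
  · refine iSup₂_le fun s hs => ?_
    calc ENNReal.ofReal (s ^ (1 / p)) * (c * h s) = c * (ENNReal.ofReal (s ^ (1 / p)) * h s) := by
          ring
      _ ≤ _ := by
          gcongr
          exact le_iSup₂ (f := fun s (_ : s ∈ Ioi (0 : ℝ)) => ENNReal.ofReal (s ^ (1 / p)) * h s)
            s hs
  · have hQ : 0 < q.toReal := zero_lt_one.trans_le (one_le_toReal_of_ne_top hq hqt)
    have e : ∀ s, (ENNReal.ofReal (s ^ (1 / p - 1 / q.toReal)) * (c * h s)) ^ q.toReal =
        c ^ q.toReal * (ENNReal.ofReal (s ^ (1 / p - 1 / q.toReal)) * h s) ^ q.toReal := fun s => by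
      rw [mul_left_comm, ENNReal.mul_rpow_of_nonneg _ _ hQ.le]
    simp_rw [e]
    rw [lintegral_const_mul' _ _ (ENNReal.rpow_ne_top_of_nonneg hQ.le hc),
      ENNReal.mul_rpow_of_nonneg _ _ (by positivity), ← ENNReal.rpow_mul,
      mul_one_div_cancel hQ.ne', ENNReal.rpow_one]

theorem lorentzFun_tsum_le {ι : Type*} [Countable ι] (p : ℝ) {q : ℝ≥0∞} (hq : 1 ≤ q)
    {h : ι → ℝ → ℝ≥0∞} (hh : ∀ i, Measurable (h i)) :
    lorentzFun p q (fun s => ∑' i, h i s) ≤ ∑' i, lorentzFun p q (h i) := by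
  unfold lorentzFun
  split_ifs with hqt
  · refine iSup₂_le fun s hs => ?_
    rw [← ENNReal.tsum_mul_left]
    exact ENNReal.tsum_le_tsum fun i =>
      le_iSup₂ (f := fun s (_ : s ∈ Ioi (0 : ℝ)) => ENNReal.ofReal (s ^ (1 / p)) * h i s) s hs
  · simp_rw [← ENNReal.tsum_mul_left]
    exact lintegral_Lp_tsum_le (one_le_toReal_of_ne_top hq hqt) fun i =>
      (ENNReal.measurable_ofReal.comp (measurable_id.pow_const _)).mul (hh i)

theorem lorentzFun_add_le (p : ℝ) {q : ℝ≥0∞} (hq : 1 ≤ q) {h h' : ℝ → ℝ≥0∞}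
    (hh : Measurable h) (hh' : Measurable h') :
    lorentzFun p q (fun s => h s + h' s) ≤ lorentzFun p q h + lorentzFun p q h' := by
  have := lorentzFun_tsum_le p hq (h := fun b : Bool => cond b h h') (by
    rintro (_ | _) <;> assumption)
  simpa [tsum_fintype] using this

theorem image_mul_rpow_Ioi {c β : ℝ} (hc : 0 < c) (hβ : 0 < β) :
    (fun m : ℝ => c * m ^ β) '' Ioi 0 = Ioi 0 := by
  ext s
  constructor
  · rintro ⟨m, hm, rfl⟩
    exact mul_pos hc (Real.rpow_pos_of_pos hm _)
  · intro hs
    have h1 : 0 < s / c := div_pos hs hc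
    refine ⟨(s / c) ^ β⁻¹, Real.rpow_pos_of_pos h1 _, ?_⟩
    show c * ((s / c) ^ β⁻¹) ^ β = s
    rw [Real.rpow_inv_rpow h1.le hβ.ne', mul_div_cancel₀ _ hc.ne']

/-- Behaviour of the Lorentz functional under power changes of variables. -/
theorem lorentzFun_comp_rpow_le {P r e c β : ℝ} {q : ℝ≥0∞} (hq : 1 ≤ q) (hc : 0 < c)
    (hβ : 0 < β) (he : 1 / P + e = β / r) (h : ℝ → ℝ≥0∞) :
    lorentzFun P q (fun m => ENNReal.ofReal (m ^ e) * h (c * m ^ β)) ≤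
      ENNReal.ofReal (c ^ (-(1 / r))) * (ENNReal.ofReal (max 1 β⁻¹) * lorentzFun r q h) := by
  have hcc : c ^ (-(1 / r)) * c ^ (1 / r) = 1 := by rw [← Real.rpow_add hc]; simp
  unfold lorentzFun
  split_ifs with hqt
  · refine iSup₂_le fun m (hm : 0 < m) => ?_
    have hs : 0 < c * m ^ β := mul_pos hc (Real.rpow_pos_of_pos hm _)
    have e1 : m ^ (1 / P) * m ^ e = c ^ (-(1 / r)) * (c * m ^ β) ^ (1 / r) := by
      rw [← Real.rpow_add hm, he, Real.mul_rpow hc.le (Real.rpow_nonneg hm.le _), ← mul_assoc, hcc,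
        one_mul, ← Real.rpow_mul hm.le, mul_one_div]
    calc ENNReal.ofReal (m ^ (1 / P)) * (ENNReal.ofReal (m ^ e) * h (c * m ^ β))
        = ENNReal.ofReal (c ^ (-(1 / r))) *
            (1 * (ENNReal.ofReal ((c * m ^ β) ^ (1 / r)) * h (c * m ^ β))) := by
          rw [← mul_assoc, ← ENNReal.ofReal_mul (Real.rpow_nonneg hm.le _), e1,
            ENNReal.ofReal_mul (Real.rpow_nonneg hc.le _), one_mul, mul_assoc]
      _ ≤ _ := by
          gcongr
          · rw [← ENNReal.ofReal_one]
            exact ENNReal.ofReal_le_ofReal (le_max_left _ _)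
          · exact le_iSup₂ (f := fun s (_ : s ∈ Ioi (0 : ℝ)) =>
              ENNReal.ofReal (s ^ (1 / r)) * h s) (c * m ^ β) hs
  · set Q := q.toReal with hQd
    have hQ1 : 1 ≤ Q := one_le_toReal_of_ne_top hq hqt
    have hQ : 0 < Q := by linarith
    have hsub := lintegral_image_eq_lintegral_abs_deriv_mul (f := fun m : ℝ => c * m ^ β)
      (f' := fun m => c * (β * m ^ (β - 1))) (s := Ioi 0) measurableSet_Ioi
      (fun m hm => ((Real.hasDerivAt_rpow_const (Or.inl (ne_of_gt hm))).const_mul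
        c).hasDerivWithinAt)
      (fun a (ha : 0 < a) b (hb : 0 < b) hab => by
        have := mul_left_cancel₀ hc.ne' hab
        exact (Real.rpow_left_inj ha.le hb.le hβ.ne').1 this)
      (fun s => (ENNReal.ofReal (s ^ (1 / r - 1 / Q)) * h s) ^ Q)
    rw [image_mul_rpow_Ioi hc hβ] at hsub
    set I := ∫⁻ s in Ioi (0 : ℝ), (ENNReal.ofReal (s ^ (1 / r - 1 / Q)) * h s) ^ Q with hI
    have hEq : ∫⁻ m in Ioi (0 : ℝ), (ENNReal.ofReal (m ^ (1 / P - 1 / Q)) *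
        (ENNReal.ofReal (m ^ e) * h (c * m ^ β))) ^ Q =
          ENNReal.ofReal (β⁻¹ * (c ^ (-(1 / r))) ^ Q) * I := by
      rw [hsub, ← lintegral_const_mul' _ _ ENNReal.ofReal_ne_top]
      refine setLIntegral_congr_fun measurableSet_Ioi fun m (hm : 0 < m) => ?_
      have hmβ : 0 < m ^ β := Real.rpow_pos_of_pos hm _
      have e2 : (m ^ (1 / P - 1 / Q) * m ^ e) ^ Q =
          β⁻¹ * (c ^ (-(1 / r))) ^ Q * (|c * (β * m ^ (β - 1))| *
            ((c * m ^ β) ^ (1 / r - 1 / Q)) ^ Q) := by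
        have hm1 : 0 < m ^ (β - 1) := Real.rpow_pos_of_pos hm _
        rw [abs_of_pos (by positivity), Real.mul_rpow hc.le hmβ.le,
          Real.mul_rpow (Real.rpow_nonneg hc.le _) (Real.rpow_nonneg hmβ.le _),
          ← Real.rpow_add hm, ← Real.rpow_mul hm.le, ← Real.rpow_mul hm.le, ← Real.rpow_mul hm.le,
          ← Real.rpow_mul hc.le, ← Real.rpow_mul hc.le]
        have e3 : (1 / P - 1 / Q + e) * Q = (β - 1) + β * (1 / r - 1 / Q) * Q := by
          rw [show 1 / P - 1 / Q + e = β / r - 1 / Q by linarith]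
          field_simp; ring
        have e4 : c ^ (-(1 / r) * Q) * (c * c ^ ((1 / r - 1 / Q) * Q)) = 1 := by
          nth_rewrite 2 [← Real.rpow_one c]
          rw [← Real.rpow_add hc, ← Real.rpow_add hc]
          rw [show -(1 / r) * Q + (1 + (1 / r - 1 / Q) * Q) = 0 by field_simp; ring,
            Real.rpow_zero]
        rw [e3, Real.rpow_add hm]
        calc _ = (β⁻¹ * β) * (c ^ (-(1 / r) * Q) * (c * c ^ ((1 / r - 1 / Q) * Q))) *
              (m ^ (β - 1) * m ^ (β * (1 / r - 1 / Q) * Q)) := by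
              rw [e4, inv_mul_cancel₀ hβ.ne']; ring
          _ = _ := by ring
      show (ENNReal.ofReal (m ^ (1 / P - 1 / Q)) *
        (ENNReal.ofReal (m ^ e) * h (c * m ^ β))) ^ Q = _
      rw [← mul_assoc, ← ENNReal.ofReal_mul (Real.rpow_nonneg hm.le _),
        ENNReal.mul_rpow_of_nonneg _ _ hQ.le, ENNReal.mul_rpow_of_nonneg _ _ hQ.le,
        ENNReal.ofReal_rpow_of_nonneg (by positivity) hQ.le,
        ENNReal.ofReal_rpow_of_nonneg (by positivity) hQ.le, e2,
        ENNReal.ofReal_mul (p := β⁻¹ * (c ^ (-(1 / r))) ^ Q) (by positivity),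
        ENNReal.ofReal_mul (abs_nonneg _)]
      ring
    rw [hEq, ENNReal.mul_rpow_of_nonneg _ _ (by positivity),
      ENNReal.ofReal_rpow_of_nonneg (by positivity) (by positivity),
      Real.mul_rpow (by positivity) (by positivity), ← Real.rpow_mul (by positivity),
      mul_one_div_cancel hQ.ne', Real.rpow_one, mul_comm (β⁻¹ ^ (1 / Q)),
      ENNReal.ofReal_mul (by positivity), mul_assoc]
    gcongr
    calc β⁻¹ ^ (1 / Q) ≤ (max 1 β⁻¹) ^ (1 / Q) := by
          gcongr
          exact le_max_right _ _
      _ ≤ (max 1 β⁻¹) ^ (1 : ℝ) := by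
          refine Real.rpow_le_rpow_of_exponent_le (le_max_left _ _) ?_
          rw [div_le_one hQ]; exact hQ1
      _ = _ := Real.rpow_one _

theorem tsum_half_pow_ne_top {r : ℝ} (hr : 1 < r) :
    ∑' k : ℕ, ENNReal.ofReal ((1 / 2) ^ k) * ENNReal.ofReal (((1 / 2) ^ k) ^ (-(1 / r))) ≠ ⊤ := by
  have hr' : 1 / r < 1 := by rw [div_lt_one (by linarith)]; exact hr
  have e : ∀ k : ℕ, ENNReal.ofReal ((1 / 2) ^ k) * ENNReal.ofReal (((1 / 2) ^ k) ^ (-(1 / r))) =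
      ENNReal.ofReal (((1 / 2 : ℝ) ^ (1 - 1 / r)) ^ k) := fun k => by
    have h2 : (0 : ℝ) < (1 / 2) ^ k := by positivity
    rw [← ENNReal.ofReal_mul h2.le]
    congr 1
    nth_rewrite 1 [← Real.rpow_one ((1 / 2 : ℝ) ^ k)]
    rw [← Real.rpow_add h2, Real.rpow_pow_comm (by norm_num)]
    rfl
  simp_rw [e]
  refine (summable_geometric_of_lt_one (by positivity) ?_).tsum_ofReal_ne_top
  exact Real.rpow_lt_one (by norm_num) (by norm_num) (by linarith)

theorem tsum_min_two_zpow_ne_top {a p : ℝ} (hp : 1 < p) (hap : a < 1 / p) :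
    ∑' k : ℤ, ENNReal.ofReal (min (((2 : ℝ) ^ k) ^ a) (2 ^ k)) *
      ENNReal.ofReal (((2 : ℝ) ^ k) ^ (-(1 / p))) ≠ ⊤ := by
  have hp' : 1 / p < 1 := by rw [div_lt_one (by linarith)]; exact hp
  have e : ∀ k : ℤ, ENNReal.ofReal (min (((2 : ℝ) ^ k) ^ a) (2 ^ k)) *
      ENNReal.ofReal (((2 : ℝ) ^ k) ^ (-(1 / p))) =
      ENNReal.ofReal (min (((2 : ℝ) ^ k) ^ a) (2 ^ k) * ((2 : ℝ) ^ k) ^ (-(1 / p))) := fun k => by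
    rw [← ENNReal.ofReal_mul (by positivity)]
  simp_rw [e]
  refine Summable.tsum_ofReal_ne_top (Summable.of_nat_of_neg ?_ ?_)
  · refine Summable.of_nonneg_of_le (fun k => by positivity) (fun k => ?_)
      (summable_geometric_of_lt_one (r := (2 : ℝ) ^ (a - 1 / p)) (by positivity)
        (Real.rpow_lt_one_of_one_lt_of_neg (by norm_num) (by linarith)))
    have h2 : (0 : ℝ) < 2 ^ k := by positivity
    rw [zpow_natCast]
    calc _ ≤ ((2 : ℝ) ^ k) ^ a * ((2 : ℝ) ^ k) ^ (-(1 / p)) := by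
          gcongr
          exact min_le_left _ _
      _ = _ := by
          rw [← Real.rpow_add h2, Real.rpow_pow_comm (by norm_num)]
          rfl
  · refine Summable.of_nonneg_of_le (fun k => by positivity) (fun k => ?_)
      (summable_geometric_of_lt_one (r := (1 / 2 : ℝ) ^ (1 - 1 / p)) (by positivity)
        (Real.rpow_lt_one (by norm_num) (by norm_num) (by linarith)))
    have h2 : (0 : ℝ) < (1 / 2) ^ k := by positivity
    rw [show (2 : ℝ) ^ (-(k : ℤ)) = (1 / 2) ^ k by
      rw [zpow_neg, zpow_natCast, one_div, inv_pow]]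
    calc _ ≤ (1 / 2 : ℝ) ^ k * ((1 / 2 : ℝ) ^ k) ^ (-(1 / p)) := by
          gcongr
          exact min_le_right _ _
      _ = ((1 / 2 : ℝ) ^ k) ^ (1 - 1 / p) := by
          nth_rewrite 1 [← Real.rpow_one ((1 / 2 : ℝ) ^ k)]
          rw [← Real.rpow_add h2]
          rfl
      _ = _ := by rw [Real.rpow_pow_comm (by norm_num)]

/-- Summing the power changes of variables of `lorentzFun_comp_rpow_le`. -/
theorem lorentzFun_tsum_comp_rpow_le {ι : Type*} [Countable ι] {P r e β : ℝ} {q : ℝ≥0∞}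
    (hq : 1 ≤ q) (hβ : 0 < β) (he : 1 / P + e = β / r) {w : ι → ℝ≥0∞} (hw : ∀ i, w i ≠ ⊤)
    {c : ι → ℝ} (hc : ∀ i, 0 < c i) {h : ℝ → ℝ≥0∞} (hh : Measurable h) :
    lorentzFun P q (fun m => ENNReal.ofReal (m ^ e) * ∑' i, w i * h (c i * m ^ β)) ≤
      (∑' i, w i * ENNReal.ofReal (c i ^ (-(1 / r)))) *
        (ENNReal.ofReal (max 1 β⁻¹) * lorentzFun r q h) := by
  have hm : ∀ i, Measurable fun m : ℝ => w i * (ENNReal.ofReal (m ^ e) * h (c i * m ^ β)) :=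
    fun i => ((ENNReal.measurable_ofReal.comp (measurable_id.pow_const _)).mul
      (hh.comp ((measurable_id.pow_const _).const_mul _))).const_mul _
  calc lorentzFun P q (fun m => ENNReal.ofReal (m ^ e) * ∑' i, w i * h (c i * m ^ β))
      = lorentzFun P q (fun m => ∑' i, w i * (ENNReal.ofReal (m ^ e) * h (c i * m ^ β))) := by
        congr 1
        ext m
        rw [← ENNReal.tsum_mul_left]
        exact tsum_congr fun i => mul_left_comm _ _ _
    _ ≤ ∑' i, lorentzFun P q (fun m => w i * (ENNReal.ofReal (m ^ e) * h (c i * m ^ β))) :=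
        lorentzFun_tsum_le P hq hm
    _ ≤ ∑' i, w i * ENNReal.ofReal (c i ^ (-(1 / r))) *
          (ENNReal.ofReal (max 1 β⁻¹) * lorentzFun r q h) := by
        refine ENNReal.tsum_le_tsum fun i => (lorentzFun_const_mul_le P hq (hw i) _).trans ?_
        rw [mul_assoc]
        gcongr
        exact lorentzFun_comp_rpow_le hq (hc i) hβ he h
    _ = _ := ENNReal.tsum_mul_right

/-- **Theorem (Lorentz–Sobolev inequality, subcritical case).** For `1 < p < n` and
`1 ≤ q ≤ ∞` there is `C = C(n, p, q, α, Cμ)` such that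
`‖u‖_{L^{αp/(n-p),q}(Ω,μ)} ≤ C (‖Eu‖_{L^{p,q}(Ω)} + ‖u‖_{L^{p(n-1)/(n-p),q}(∂Ω)})`
for every `u ∈ E¹L^{p,q}(Ω) ∩ C_b(Ω̄)`. -/
theorem lorentz_sobolev_subcritical (n : ℕ) (hn : 2 ≤ n) (α Cμ p : ℝ) (q : ℝ≥0∞)
    (hα1 : (n : ℝ) - 1 < α) (hα2 : α ≤ n) (hCμ : 0 < Cμ)
    (hp1 : 1 < p) (hpn : p < n) (hq : 1 ≤ q) :
    ∃ C : ℝ, 0 < C ∧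
      ∀ (Ω : Set (Euc n)), IsOpen Ω →
      ∀ μ : Measure (Euc n), μ Ωᶜ = 0 → AhlforsUpper n Ω μ α Cμ →
      ∀ (u : Euc n → Euc n) (E : Euc n → EuclideanSpace ℝ (Fin n × Fin n)),
        IsSymmGradOn n Ω u E →
        lorentzNorm (volume.restrict Ω) p q (fun x => ‖E x‖) ≠ ⊤ →
        MemCb n Ω u →
        lorentzNorm μ (α * p / ((n : ℝ) - p)) q (fun x => ‖u x‖) ≤
          ENNReal.ofReal C *
            (lorentzNorm (volume.restrict Ω) p q (fun x => ‖E x‖) +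
              lorentzNorm (μH[(n : ℝ) - 1].restrict (frontier Ω))
                (p * ((n : ℝ) - 1) / ((n : ℝ) - p)) q (fun x => ‖u x‖)) := by
  obtain ⟨C₀, hC₀⟩ := exists_rearr_le n hn α Cμ hα1 hCμ
  have hn2 : (2 : ℝ) ≤ n := by exact_mod_cast hn
  have hn1 : 0 < (n : ℝ) - 1 := by linarith
  have hα : 0 < α := by linarith
  have hp : 0 < p := by linarith
  have hnp : 0 < (n : ℝ) - p := by linarith
  set r : ℝ := p * ((n : ℝ) - 1) / ((n : ℝ) - p) with hr
  set P : ℝ := α * p / ((n : ℝ) - p) with hP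
  have hr1 : 1 < r := by
    rw [hr, one_lt_div hnp]
    nlinarith
  have hT₁ := tsum_half_pow_ne_top hr1
  have hT₂ := tsum_min_two_zpow_ne_top (a := 1 / (n : ℝ)) hp1
    (one_div_lt_one_div_of_lt hp hpn)
  set T₁ := ∑' k : ℕ, ENNReal.ofReal ((1 / 2) ^ k) *
    ENNReal.ofReal (((1 / 2) ^ k) ^ (-(1 / r))) with hT₁d
  set T₂ := ∑' k : ℤ, ENNReal.ofReal (min (((2 : ℝ) ^ k) ^ (1 / (n : ℝ))) (2 ^ k)) *
    ENNReal.ofReal (((2 : ℝ) ^ k) ^ (-(1 / p))) with hT₂d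
  set M₁ := ENNReal.ofReal (max 1 (((n : ℝ) - 1) / α)⁻¹) with hM₁
  set M₂ := ENNReal.ofReal (max 1 ((n : ℝ) / α)⁻¹) with hM₂
  set D : ℝ≥0∞ := C₀ * (T₁ * M₁ + T₂ * M₂) with hD
  have hDt : D ≠ ⊤ := ENNReal.mul_ne_top ENNReal.coe_ne_top (ENNReal.add_ne_top.2
    ⟨ENNReal.mul_ne_top hT₁ ENNReal.ofReal_ne_top, ENNReal.mul_ne_top hT₂ ENNReal.ofReal_ne_top⟩)
  refine ⟨D.toReal + 1, by positivity, fun Ω hΩ μ hμ hA u E hE _ hu => ?_⟩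
  simp only [lorentzNorm_eq]
  set g := rearr (μH[(n : ℝ) - 1].restrict (frontier Ω)) (fun x => ‖u x‖) with hg
  set f := rearr (volume.restrict Ω) (fun x => ‖E x‖) with hf
  have hgm : Measurable g := (rearr_antitone _ _).measurable
  have hfm : Measurable f := (rearr_antitone _ _).measurable
  have hpow : ∀ e : ℝ, Measurable fun m : ℝ => ENNReal.ofReal (m ^ e) := fun e =>
    ENNReal.measurable_ofReal.comp (measurable_id.pow_const _)
  calc lorentzFun P q (rearr μ fun x => ‖u x‖)
      ≤ lorentzFun P q (fun m => C₀ *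
          (ENNReal.ofReal (m ^ (0 : ℝ)) * (∑' k : ℕ, ENNReal.ofReal ((1 / 2) ^ k) *
              g ((1 / 2) ^ k * m ^ (((n : ℝ) - 1) / α))) +
            ENNReal.ofReal (m ^ (1 / α)) * ∑' k : ℤ,
              ENNReal.ofReal (min (((2 : ℝ) ^ k) ^ (1 / (n : ℝ))) (2 ^ k)) *
                f (2 ^ k * m ^ ((n : ℝ) / α)))) :=
        lorentzFun_mono P q fun m hm => by
          simpa only [Real.rpow_zero, ENNReal.ofReal_one, one_mul] using
            hC₀ Ω hΩ μ hμ hA u E hE hu m hm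
    _ ≤ C₀ * (T₁ * (M₁ * lorentzFun r q g) + T₂ * (M₂ * lorentzFun p q f)) := by
        refine (lorentzFun_const_mul_le P hq ENNReal.coe_ne_top _).trans ?_
        gcongr
        refine (lorentzFun_add_le P hq ?_ ?_).trans (add_le_add ?_ ?_)
        · exact (hpow _).mul (Measurable.tsum fun k =>
            (hgm.comp ((measurable_id.pow_const _).const_mul _)).const_mul _)
        · exact (hpow _).mul (Measurable.tsum fun k =>
            (hfm.comp ((measurable_id.pow_const _).const_mul _)).const_mul _)
        · refine lorentzFun_tsum_comp_rpow_le hq (by positivity) ?_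
            (fun _ => ENNReal.ofReal_ne_top) (fun k => by positivity) hgm
          rw [hr, hP]
          field_simp
          ring
        · refine lorentzFun_tsum_comp_rpow_le hq (by positivity) ?_
            (fun _ => ENNReal.ofReal_ne_top) (fun k => by positivity) hfm
          rw [hP]
          field_simp
          ring
    _ ≤ C₀ * (T₁ * (M₁ * (lorentzFun p q f + lorentzFun r q g)) +
          T₂ * (M₂ * (lorentzFun p q f + lorentzFun r q g))) := by
        gcongr
        · exact le_add_self
        · exact le_self_add
    _ = D * (lorentzFun p q f + lorentzFun r q g) := by rw [hD]; ring
    _ ≤ _ := by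
        gcongr
        rw [← ENNReal.ofReal_toReal hDt]
        exact ENNReal.ofReal_le_ofReal (by rw [ENNReal.toReal_ofReal (by positivity)]; linarith)

end
end

section
/- Let n ≥ 2, α ∈ (n−1, n], and L, M ∈ (0, ∞). Then there exists a constant C = C(n, α, L, M) such that for every non-increasing function φ: (0, ∞) → [0, ∞) with support contained in (0, M), one has ( ∫_0^L [ s^{−1/n} (log(1 + L/s))^{−1} ∫_{s^{n/α}}^∞ r^{−(n−1)/n} φ(r) dr ]^n ds )^{1/n} ≤ C ( ∫_0^M φ(r)^n dr )^{1/n}. -/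
open MeasureTheory Set
open scoped ENNReal NNReal

noncomputable section

/-- If `G` is a primitive of `g ≥ 0` on `(a, b)` with values in `[0, B]`, then `∫_a^b g ≤ B`. -/
lemma lintegral_Ioo_le_of_hasDerivAt {a b B : ℝ} {G g : ℝ → ℝ} (hgm : Measurable g)
    (hG : ∀ x ∈ Ioo a b, HasDerivAt G (g x) x) (hg : ∀ x ∈ Ioo a b, 0 ≤ g x)
    (hG0 : ∀ x ∈ Ioo a b, 0 ≤ G x) (hGB : ∀ x ∈ Ioo a b, G x ≤ B) :
    ∫⁻ x in Ioo a b, ENNReal.ofReal (g x) ≤ ENNReal.ofReal B := by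
  have hlim : Filter.Tendsto (fun ε : ℝ => a + ε) (nhdsWithin 0 (Ioi 0)) (nhds a) := by
    refine Filter.Tendsto.mono_left ?_ nhdsWithin_le_nhds
    exact Continuous.tendsto' (by fun_prop) _ _ (by simp)
  have hlim' : Filter.Tendsto (fun ε : ℝ => b - ε) (nhdsWithin 0 (Ioi 0)) (nhds b) := by
    refine Filter.Tendsto.mono_left ?_ nhdsWithin_le_nhds
    exact Continuous.tendsto' (by fun_prop) _ _ (by simp)
  refine le_of_tendsto ((aecover_Ioo_of_Icc (μ := volume) hlim
    hlim').lintegral_tendsto_of_countably_generated hgm.ennreal_ofReal.aemeasurable) ?_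
  filter_upwards [self_mem_nhdsWithin] with ε hε
  have hε : 0 < ε := hε
  rw [Measure.restrict_restrict measurableSet_Icc]
  refine (lintegral_mono_set inter_subset_left).trans ?_
  rcases lt_or_ge (b - ε) (a + ε) with h | h
  · simp [Icc_eq_empty (not_le.2 h)]
  have hsub : ∀ x ∈ Icc (a + ε) (b - ε), x ∈ Ioo a b := fun x hx =>
    ⟨by linarith [hx.1], by linarith [hx.2]⟩
  have hsub' : ∀ x ∈ Ioo (a + ε) (b - ε), x ∈ Ioo a b := fun x hx => hsub x (Ioo_subset_Icc_self hx)
  have hcont : ContinuousOn G (Icc (a + ε) (b - ε)) := fun x hx =>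
    (hG x (hsub x hx)).continuousAt.continuousWithinAt
  have hint : IntegrableOn g (Ioc (a + ε) (b - ε)) :=
    intervalIntegral.integrableOn_deriv_of_nonneg hcont (fun x hx => hG x (hsub' x hx))
      (fun x hx => hg x (hsub' x hx))
  have heq := intervalIntegral.integral_eq_sub_of_hasDerivAt_of_le h hcont
    (fun x hx => hG x (hsub' x hx)) ((intervalIntegrable_iff_integrableOn_Ioc_of_le h).2 hint)
  rw [setLIntegral_congr Ioc_ae_eq_Icc.symm, ← ofReal_integral_eq_lintegral_ofReal hint,
    ← intervalIntegral.integral_of_le h, heq]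
  · refine ENNReal.ofReal_le_ofReal ?_
    linarith [hG0 _ (hsub _ (left_mem_Icc.2 h)), hGB _ (hsub _ (right_mem_Icc.2 h))]
  · filter_upwards [ae_restrict_mem measurableSet_Ioc] with x hx
    exact hg x (hsub x (Ioc_subset_Icc_self hx))

/-- Hölder's inequality for the Hardy operator, with a power of the logarithm as weight. -/
lemma rpow_lintegral_le_log_mul_lintegral {p K σ : ℝ} (hp : 1 < p) (hσ : 0 < σ) {f : ℝ → ℝ≥0∞}
    (hf : AEMeasurable f (volume.restrict (Ioo σ K))) :
    (∫⁻ r in Ioo σ K, ENNReal.ofReal (r ^ (-((p - 1) / p))) * f r) ^ p ≤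
      ENNReal.ofReal ((2 * (Real.log K - Real.log σ) ^ (1 / 2 : ℝ)) ^ (p - 1)) *
        ∫⁻ r in Ioo σ K,
          ENNReal.ofReal ((Real.log K - Real.log r) ^ ((p - 1) / 2)) * f r ^ p := by
  have hp0 : 0 < p := by linarith
  have hp1 : 0 < p - 1 := by linarith
  rcases le_or_gt K σ with hKσ | hKσ
  · simp [Ioo_eq_empty (not_lt.2 hKσ), hp0]
  have hT : ∀ r ∈ Ioo σ K, 0 < Real.log K - Real.log r := fun r hr =>
    sub_pos.2 (Real.log_lt_log (hσ.trans hr.1) hr.2)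
  set u : ℝ → ℝ≥0∞ := fun r => ENNReal.ofReal
    (r ^ (-((p - 1) / p)) * (Real.log K - Real.log r) ^ (-((p - 1) / (2 * p)))) with hu
  set v : ℝ → ℝ≥0∞ := fun r => ENNReal.ofReal
    ((Real.log K - Real.log r) ^ ((p - 1) / (2 * p))) * f r with hv
  have hsplit : ∫⁻ r in Ioo σ K, ENNReal.ofReal (r ^ (-((p - 1) / p))) * f r =
      ∫⁻ r in Ioo σ K, (v * u) r := by
    refine setLIntegral_congr_fun measurableSet_Ioo fun r hr => ?_
    have hr0 : 0 < r := hσ.trans hr.1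
    simp only [hu, hv, Pi.mul_apply]
    rw [mul_comm, mul_comm _ (f r), mul_assoc, ← ENNReal.ofReal_mul (by have := hT r hr; positivity),
      mul_left_comm, ← Real.rpow_add (hT r hr)]
    simp
  have hU : ∫⁻ r in Ioo σ K, u r ^ (p / (p - 1)) ≤
      ENNReal.ofReal (2 * (Real.log K - Real.log σ) ^ (1 / 2 : ℝ)) := by
    have : ∫⁻ r in Ioo σ K, u r ^ (p / (p - 1)) =
        ∫⁻ r in Ioo σ K, ENNReal.ofReal
          (r⁻¹ * (Real.log K - Real.log r) ^ (-(1 / 2) : ℝ)) := by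
      refine setLIntegral_congr_fun measurableSet_Ioo fun r hr => ?_
      have hr0 : 0 < r := hσ.trans hr.1
      have hTr := hT r hr
      simp only [hu]
      rw [ENNReal.ofReal_rpow_of_nonneg (by positivity) (by positivity),
        Real.mul_rpow (by positivity) (by positivity), ← Real.rpow_mul hr0.le,
        ← Real.rpow_mul hTr.le, ← Real.rpow_neg_one]
      congr 3 <;> field_simp
    rw [this]
    refine lintegral_Ioo_le_of_hasDerivAt
      (G := fun r => 2 * (Real.log K - Real.log σ) ^ (1 / 2 : ℝ) -
        2 * (Real.log K - Real.log r) ^ (1 / 2 : ℝ)) (by fun_prop) ?_ ?_ ?_ ?_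
    · intro r hr
      have hr0 : 0 < r := hσ.trans hr.1
      have hTr := hT r hr
      have h1 := ((((Real.hasDerivAt_log hr0.ne').const_sub (Real.log K)).rpow_const
        (p := (1 / 2 : ℝ)) (Or.inl hTr.ne')).const_mul 2).const_sub
          (2 * (Real.log K - Real.log σ) ^ (1 / 2 : ℝ))
      refine h1.congr_deriv ?_
      rw [show (1 / 2 - 1 : ℝ) = -(1 / 2) by norm_num]
      ring
    · intro r hr
      have hr0 : 0 < r := hσ.trans hr.1
      have hTr := hT r hr
      positivity
    · intro r hr
      have hTr := hT r hr
      have := Real.log_le_log hσ hr.1.le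
      have : (Real.log K - Real.log r) ^ (1 / 2 : ℝ) ≤ (Real.log K - Real.log σ) ^ (1 / 2 : ℝ) :=
        Real.rpow_le_rpow hTr.le (by linarith) (by norm_num)
      linarith
    · intro r hr
      have hTr := hT r hr
      have : 0 ≤ (Real.log K - Real.log r) ^ (1 / 2 : ℝ) := by positivity
      linarith
  have hV : ∫⁻ r in Ioo σ K, v r ^ p = ∫⁻ r in Ioo σ K,
      ENNReal.ofReal ((Real.log K - Real.log r) ^ ((p - 1) / 2)) * f r ^ p := by
    refine setLIntegral_congr_fun measurableSet_Ioo fun r hr => ?_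
    have hTr := hT r hr
    simp only [hv]
    rw [ENNReal.mul_rpow_of_nonneg _ _ hp0.le,
      ENNReal.ofReal_rpow_of_nonneg (by positivity) hp0.le, ← Real.rpow_mul hTr.le]
    congr 3
    field_simp
  have hpq : p.HolderConjugate (p / (p - 1)) := Real.HolderConjugate.conjExponent hp
  have hum : Measurable u := by fun_prop
  have hvm : AEMeasurable v (volume.restrict (Ioo σ K)) :=
    AEMeasurable.mul (by fun_prop) hf
  have hH := ENNReal.lintegral_mul_le_Lp_mul_Lq _ hpq hvm hum.aemeasurable
  have hT0 : 0 < Real.log K - Real.log σ := sub_pos.2 (Real.log_lt_log hσ hKσ)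
  rw [hsplit]
  calc _ ≤ _ := ENNReal.rpow_le_rpow hH hp0.le
    _ = (∫⁻ r in Ioo σ K, u r ^ (p / (p - 1))) ^ (p - 1) * ∫⁻ r in Ioo σ K, v r ^ p := by
        rw [ENNReal.mul_rpow_of_nonneg _ _ hp0.le, ← ENNReal.rpow_mul, ← ENNReal.rpow_mul,
          one_div_mul_cancel hp0.ne', ENNReal.rpow_one, mul_comm]
        congr 2
        field_simp
    _ ≤ _ := by
        rw [hV, ← ENNReal.ofReal_rpow_of_nonneg (by positivity) hp1.le]
        gcongr

lemma lintegral_inv_mul_log_rpow_le {p c K r : ℝ} (hp : 1 < p) (hc : 0 < c) (hr0 : 0 < r)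
    (hr : r < K) :
    ∫⁻ s in Ioo 0 (r ^ (1 / c)),
        ENNReal.ofReal (s⁻¹ * (Real.log K - c * Real.log s) ^ (-((p + 1) / 2))) ≤
      ENNReal.ofReal (2 / (c * (p - 1)) * (Real.log K - Real.log r) ^ (-((p - 1) / 2))) := by
  have hp1 : 0 < p - 1 := by linarith
  have hTr : 0 < Real.log K - Real.log r := sub_pos.2 (Real.log_lt_log hr0 hr)
  have hle : ∀ s ∈ Ioo 0 (r ^ (1 / c)), Real.log K - Real.log r ≤ Real.log K - c * Real.log s := by
    intro s hs
    have := Real.log_le_log hs.1 hs.2.le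
    rw [Real.log_rpow hr0, one_div, inv_mul_eq_div, le_div_iff₀ hc] at this
    linarith
  refine lintegral_Ioo_le_of_hasDerivAt (G := fun s =>
      2 / (c * (p - 1)) * (Real.log K - c * Real.log s) ^ (-((p - 1) / 2)))
      (by fun_prop) ?_ ?_ ?_ ?_
  · intro s hs
    have hT := hTr.trans_le (hle s hs)
    have h1 := ((((Real.hasDerivAt_log hs.1.ne').const_mul c).const_sub (Real.log K)).rpow_const
        (p := -((p - 1) / 2)) (Or.inl hT.ne')).const_mul (2 / (c * (p - 1)))
    refine h1.congr_deriv ?_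
    rw [show -((p - 1) / 2) - 1 = -((p + 1) / 2) by ring]
    field_simp
  · intro s hs
    have hT := hTr.trans_le (hle s hs)
    have := hs.1
    positivity
  · intro s hs
    have hT := hTr.trans_le (hle s hs)
    positivity
  · intro s hs
    refine mul_le_mul_of_nonneg_left ?_ (by positivity)
    exact Real.rpow_le_rpow_of_nonpos hTr (hle s hs) (by linarith)

/-- A Hardy inequality with logarithmic weight, up to the endpoint singularity of the weight. -/
lemma lintegral_hardy_log_le {p c K L : ℝ} (hp : 1 < p) (hc : 0 < c) (hLK : L ^ c ≤ K)
    {f : ℝ → ℝ≥0∞} (hf : AEMeasurable f (volume.restrict (Ioo 0 K))) :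
    ∫⁻ s in Ioo 0 L, ENNReal.ofReal (s⁻¹ * (Real.log K - c * Real.log s) ^ (-p)) *
        (∫⁻ r in Ioo (s ^ c) K, ENNReal.ofReal (r ^ (-((p - 1) / p))) * f r) ^ p ≤
      ENNReal.ofReal (2 ^ (p - 1) * (2 / (c * (p - 1)))) * ∫⁻ r in Ioo 0 K, f r ^ p := by
  have hp0 : 0 < p := by linarith
  have hp1 : 0 < p - 1 := by linarith
  set w : ℝ → ℝ≥0∞ := fun s =>
    ENNReal.ofReal (s⁻¹ * (Real.log K - c * Real.log s) ^ (-((p + 1) / 2))) with hw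
  set g : ℝ → ℝ≥0∞ := fun r =>
    ENNReal.ofReal ((Real.log K - Real.log r) ^ ((p - 1) / 2)) * f r ^ p with hg
  have hgm : AEMeasurable g (volume.restrict (Ioo 0 K)) :=
    AEMeasurable.mul (by fun_prop) (hf.pow_const p)
  have hwm : Measurable w := by fun_prop
  set A : Set (ℝ × ℝ) := {z | z.1 ^ c < z.2} with hA
  have hAm : MeasurableSet A := measurableSet_lt (by fun_prop) measurable_snd
  set k : ℝ → ℝ → ℝ≥0∞ := fun s r => A.indicator (fun z => w z.1 * g z.2) (s, r) with hk
  have hkm : AEMeasurable (Function.uncurry k)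
      ((volume.restrict (Ioo 0 L)).prod (volume.restrict (Ioo 0 K))) :=
    (hwm.aemeasurable.comp_fst.mul hgm.comp_snd).indicator hAm
  have hpt : ∀ s ∈ Ioo 0 L, ENNReal.ofReal (s⁻¹ * (Real.log K - c * Real.log s) ^ (-p)) *
        (∫⁻ r in Ioo (s ^ c) K, ENNReal.ofReal (r ^ (-((p - 1) / p))) * f r) ^ p ≤
      ENNReal.ofReal (2 ^ (p - 1)) * ∫⁻ r in Ioo 0 K, k s r := by
    intro s hs
    have hs0 := hs.1
    have hsc : 0 < s ^ c := Real.rpow_pos_of_pos hs0 c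
    have hsK : s ^ c < K := (Real.rpow_lt_rpow hs0.le hs.2 hc).trans_le hLK
    have hT : 0 < Real.log K - c * Real.log s := by
      rw [← Real.log_rpow hs0]
      exact sub_pos.2 (Real.log_lt_log hsc hsK)
    have hkint : ∫⁻ r in Ioo 0 K, k s r = w s * ∫⁻ r in Ioo (s ^ c) K, g r := by
      have h1 : ∀ r, k s r = (Ioi (s ^ c)).indicator (fun r => w s * g r) r := fun r => by
        simp [hk, hA, indicator_apply]
      simp only [h1]
      rw [lintegral_indicator measurableSet_Ioi, Measure.restrict_restrict measurableSet_Ioi,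
        lintegral_const_mul' _ _ ENNReal.ofReal_ne_top]
      congr 3
      ext r
      simp only [mem_inter_iff, mem_Ioi, mem_Ioo]
      exact ⟨fun h => ⟨h.1, h.2.2⟩, fun h => ⟨h.1, hsc.trans h.1, h.2⟩⟩
    have h2 := rpow_lintegral_le_log_mul_lintegral (K := K) hp hsc
      (hf.mono_measure (Measure.restrict_mono (Ioo_subset_Ioo_left hsc.le) le_rfl))
    rw [Real.log_rpow hs0] at h2
    rw [hkint]
    refine (mul_le_mul_right h2 _).trans_eq ?_
    rw [← mul_assoc, ← mul_assoc, ← ENNReal.ofReal_mul (by positivity),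
      ← ENNReal.ofReal_mul (by positivity)]
    congr 2
    rw [Real.mul_rpow (by norm_num) (by positivity), ← Real.rpow_mul hT.le,
      show -((p + 1) / 2) = -p + 1 / 2 * (p - 1) by ring, Real.rpow_add hT]
    ring
  have hinner : ∀ r ∈ Ioo 0 K, ∫⁻ s in Ioo 0 L, k s r ≤
      ENNReal.ofReal (2 / (c * (p - 1))) * f r ^ p := by
    intro r hr
    have hTr : 0 < Real.log K - Real.log r := sub_pos.2 (Real.log_lt_log hr.1 hr.2)
    have h1 : ∀ s ∈ Ioo 0 L, k s r = (Iio (r ^ (1 / c))).indicator (fun s => w s * g r) s := by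
      intro s hs
      have : s ^ c < r ↔ s < r ^ (1 / c) := by
        rw [one_div, Real.lt_rpow_inv_iff_of_pos hs.1.le hr.1.le hc]
      simp [hk, hA, indicator_apply, this]
    rw [setLIntegral_congr_fun measurableSet_Ioo h1, lintegral_indicator measurableSet_Iio,
      Measure.restrict_restrict measurableSet_Iio]
    calc _ ≤ ∫⁻ s in Ioo 0 (r ^ (1 / c)), w s * g r :=
          lintegral_mono_set fun s hs => ⟨hs.2.1, hs.1⟩
      _ = (∫⁻ s in Ioo 0 (r ^ (1 / c)), w s) * g r := lintegral_mul_const _ hwm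
      _ ≤ _ := mul_le_mul_left (lintegral_inv_mul_log_rpow_le hp hc hr.1 hr.2) _
      _ = _ := by
          rw [hg, ← mul_assoc, ← ENNReal.ofReal_mul (by positivity), mul_assoc,
            ← Real.rpow_add hTr]
          simp
  calc _ ≤ ∫⁻ s in Ioo 0 L, ENNReal.ofReal (2 ^ (p - 1)) * ∫⁻ r in Ioo 0 K, k s r :=
        setLIntegral_mono' measurableSet_Ioo hpt
    _ = ENNReal.ofReal (2 ^ (p - 1)) * ∫⁻ r in Ioo 0 K, ∫⁻ s in Ioo 0 L, k s r := by
        rw [lintegral_const_mul' _ _ ENNReal.ofReal_ne_top, lintegral_lintegral_swap hkm]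
    _ ≤ ENNReal.ofReal (2 ^ (p - 1)) *
          ∫⁻ r in Ioo 0 K, ENNReal.ofReal (2 / (c * (p - 1))) * f r ^ p :=
        mul_le_mul_right (setLIntegral_mono' measurableSet_Ioo hinner) _
    _ = _ := by
        rw [lintegral_const_mul' _ _ ENNReal.ofReal_ne_top, ← mul_assoc,
          ENNReal.ofReal_mul (by positivity)]

/-- The logarithm of a power is controlled by the Lorentz–Zygmund weight. -/
lemma exists_log_sub_le_mul_log_one_add {c K L : ℝ} (hc : 0 < c) (hL : 0 < L)
    (hLK : L ^ c ≤ K) :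
    ∃ D : ℝ, 0 < D ∧ ∀ s ∈ Ioo 0 L,
      Real.log K - c * Real.log s ≤ D * Real.log (1 + L / s) := by
  have hB : 0 ≤ Real.log K - c * Real.log L := by
    rw [← Real.log_rpow hL]
    exact sub_nonneg.2 (Real.log_le_log (by positivity) hLK)
  have h2 : 0 < Real.log 2 := Real.log_pos (by norm_num)
  refine ⟨(Real.log K - c * Real.log L) / Real.log 2 + c, by positivity, fun s hs => ?_⟩
  have hLs : 1 < L / s := (one_lt_div hs.1).2 hs.2
  have h3 : Real.log 2 ≤ Real.log (1 + L / s) := Real.log_le_log (by norm_num) (by linarith)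
  have h4 : Real.log (L / s) ≤ Real.log (1 + L / s) :=
    Real.log_le_log (by linarith) (by linarith)
  rw [Real.log_div hL.ne' hs.1.ne'] at h4
  have h5 : Real.log K - c * Real.log L ≤
      (Real.log K - c * Real.log L) / Real.log 2 * Real.log (1 + L / s) := by
    rw [div_mul_eq_mul_div, le_div_iff₀ h2]
    exact mul_le_mul_of_nonneg_left h3 hB
  have h6 := mul_le_mul_of_nonneg_left h4 hc.le
  linarith

/-- The one-dimensional Hardy-type inequality: for `n ≥ 2`, `α ∈ (n-1, n]`,
`L, M ∈ (0,∞)`, there is `C = C(n, α, L, M)` such that, for every non-increasing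
`φ : (0,∞) → [0,∞)` supported in `(0, M)`,
`( ∫_0^L [ s^{-1/n} (log(1+L/s))⁻¹ ∫_{s^{n/α}}^∞ r^{-(n-1)/n} φ(r) dr ]ⁿ ds )^{1/n}
  ≤ C ( ∫_0^M φ(r)ⁿ dr )^{1/n}`. -/
theorem hardy_type_inequality (n : ℕ) (hn : 2 ≤ n) (α L M : ℝ)
    (hα1 : (n : ℝ) - 1 < α) (hα2 : α ≤ n) (hL : 0 < L) (hM : 0 < M) :
    ∃ C : ℝ, 0 < C ∧
      ∀ φ : ℝ → ℝ,
        (∀ s, 0 ≤ φ s) →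
        (∀ s t : ℝ, 0 < s → s ≤ t → φ t ≤ φ s) →
        (∀ s : ℝ, M ≤ s → φ s = 0) →
        (∫⁻ s in Set.Ioo (0 : ℝ) L,
            (ENNReal.ofReal (s ^ (-(1 / (n : ℝ))) * (Real.log (1 + L / s))⁻¹) *
              ∫⁻ r in Set.Ioi (s ^ ((n : ℝ) / α)),
                ENNReal.ofReal (r ^ (-(((n : ℝ) - 1) / (n : ℝ))) * φ r)) ^ (n : ℝ))
            ^ (1 / (n : ℝ)) ≤
          ENNReal.ofReal C *
            (∫⁻ r in Set.Ioo (0 : ℝ) M, ENNReal.ofReal (φ r) ^ (n : ℝ)) ^ (1 / (n : ℝ)) := by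
  have hp : 1 < (n : ℝ) := by exact_mod_cast hn
  generalize (n : ℝ) = p at *
  have hp0 : 0 < p := by linarith
  have hp1 : 0 < p - 1 := by linarith
  have hα : 0 < α := hp1.trans hα1
  set c : ℝ := p / α with hc_def
  have hc : 0 < c := by positivity
  set K : ℝ := max M (L ^ c) with hK
  have hLK : L ^ c ≤ K := le_max_right _ _
  have hMK : M ≤ K := le_max_left _ _
  obtain ⟨D, hD, hDs⟩ := exists_log_sub_le_mul_log_one_add hc hL hLK
  set E : ℝ := D ^ p * (2 ^ (p - 1) * (2 / (c * (p - 1)))) with hE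
  have hE0 : 0 < E := by positivity
  refine ⟨E ^ (1 / p), by positivity, fun φ hφ0 hφ hφM => ?_⟩
  have hf : AEMeasurable (fun r => ENNReal.ofReal (φ r)) (volume.restrict (Ioo 0 K)) :=
    (aemeasurable_restrict_of_antitoneOn measurableSet_Ioo
      fun s hs t _ hst => hφ s t hs.1 hst).ennreal_ofReal
  have hmain := lintegral_hardy_log_le hp hc hLK hf
  rw [← ENNReal.ofReal_rpow_of_nonneg hE0.le (by positivity),
    ← ENNReal.mul_rpow_of_nonneg _ _ (by positivity)]
  refine ENNReal.rpow_le_rpow ?_ (by positivity)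
  have hinner : ∀ s ∈ Ioo 0 L, ∫⁻ r in Ioi (s ^ c), ENNReal.ofReal (r ^ (-((p - 1) / p)) * φ r) =
      ∫⁻ r in Ioo (s ^ c) K, ENNReal.ofReal (r ^ (-((p - 1) / p))) * ENNReal.ofReal (φ r) := by
    intro s hs
    have hsc : 0 < s ^ c := Real.rpow_pos_of_pos hs.1 c
    rw [← lintegral_indicator measurableSet_Ioi, ← lintegral_indicator measurableSet_Ioo]
    refine lintegral_congr fun r => ?_
    simp only [indicator_apply, mem_Ioi, mem_Ioo]
    by_cases h1 : s ^ c < r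
    · by_cases h2 : r < K
      · have : 0 < r := hsc.trans h1
        simp [h1, h2, ENNReal.ofReal_mul (Real.rpow_nonneg this.le _)]
      · simp [h1, h2, hφM r (hMK.trans (not_lt.1 h2))]
    · simp [h1]
  have hnorm : ∫⁻ r in Ioo 0 K, ENNReal.ofReal (φ r) ^ p ≤
      ∫⁻ r in Ioo 0 M, ENNReal.ofReal (φ r) ^ p := by
    rw [← lintegral_indicator measurableSet_Ioo, ← lintegral_indicator measurableSet_Ioo]
    refine lintegral_mono fun r => ?_
    simp only [indicator_apply, mem_Ioo]
    by_cases h : r < M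
    · simp [h, h.trans_le hMK]
    · simp [hφM r (not_lt.1 h), hp0]
  calc _ ≤ ∫⁻ s in Ioo 0 L, ENNReal.ofReal (D ^ p) *
        (ENNReal.ofReal (s⁻¹ * (Real.log K - c * Real.log s) ^ (-p)) *
        (∫⁻ r in Ioo (s ^ c) K,
          ENNReal.ofReal (r ^ (-((p - 1) / p))) * ENNReal.ofReal (φ r)) ^ p) := by
        refine setLIntegral_mono' measurableSet_Ioo fun s hs => ?_
        have hs0 := hs.1
        have hT : 0 < Real.log K - c * Real.log s := by
          rw [← Real.log_rpow hs0]
          exact sub_pos.2 (Real.log_lt_log (by positivity)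
            ((Real.rpow_lt_rpow hs0.le hs.2 hc).trans_le hLK))
        have hl : 0 < Real.log (1 + L / s) := Real.log_pos (by have := div_pos hL hs0; linarith)
        rw [hinner s hs, ENNReal.mul_rpow_of_nonneg _ _ hp0.le, ← mul_assoc,
          ← ENNReal.ofReal_mul (by positivity),
          ENNReal.ofReal_rpow_of_nonneg (by positivity) hp0.le]
        gcongr
        rw [Real.mul_rpow (by positivity) (by positivity), ← Real.rpow_mul hs0.le,
          show -(1 / p) * p = -1 by field_simp, Real.rpow_neg_one, mul_left_comm,
          Real.rpow_neg hT.le, ← Real.inv_rpow hT.le, ← Real.mul_rpow hD.le (by positivity)]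
        gcongr
        rw [← div_eq_mul_inv, le_div_iff₀ hT, inv_mul_le_iff₀ hl, mul_comm _ D]
        exact hDs s hs
    _ ≤ _ := by
        rw [lintegral_const_mul' _ _ ENNReal.ofReal_ne_top, hE,
          ENNReal.ofReal_mul (by positivity), mul_assoc]
        exact mul_le_mul_right (hmain.trans (mul_le_mul_right hnorm _)) _

end
end
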